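/- For every double star H (a tree in which at most two vertices have degree more than one), there is a polynomial f such that every H-free finite simple graph G satisfies χ(G) ≤ f(ω(G)). -/

import Mathlib

open SimpleGraph Set

/-- `G` contains no induced subgraph isomorphic to `H`. -/
def IsInducedFree {V : Type*} {W : Type*} (G : SimpleGraph V) (H : SimpleGraph W) : Prop :=
  ∀ s : Set V, ¬ Nonempty ((G.induce s) ≃g H)

/-- The double star `H_s`: two adjacent internal vertices `0` and `1`; `0` is adjacent to the
`s` leaves `2,…,s+1` and `1` is adjacent to the `s` leaves `s+2,…,2s+1`. -/
def doubleStarGraph (s : ℕ) : SimpleGraph (Fin (2*s+2)) :=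
  SimpleGraph.fromRel (fun a b =>
    ((a : ℕ) = 0 ∧ (b : ℕ) = 1) ∨
    ((a : ℕ) = 0 ∧ 2 ≤ (b : ℕ) ∧ (b : ℕ) ≤ s+1) ∨
    ((a : ℕ) = 1 ∧ s+2 ≤ (b : ℕ)))

/-- A graph has degeneracy at most `d` if every nonempty subgraph has a vertex whose degree
in that subgraph is at most `d`. -/
def DegeneracyAtMost {V : Type*} (G : SimpleGraph V) (d : ℕ) : Prop :=
  ∀ H : G.Subgraph, H.verts.Nonempty → ∃ v ∈ H.verts, (H.neighborSet v).ncard ≤ d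

/-- A `(k,d)`-colouring: a partition of the vertex set into `k` parts, each inducing a
subgraph of degeneracy at most `d`. -/
def KDColorable {V : Type*} (G : SimpleGraph V) (k d : ℕ) : Prop :=
  ∃ f : V → Fin k, ∀ i : Fin k, DegeneracyAtMost (G.induce {v | f v = i}) d

/-- `G` contains the complete bipartite graph `K_{t,t}` as a (not necessarily induced)
subgraph. -/
def ContainsKtt {V : Type*} (G : SimpleGraph V) (t : ℕ) : Prop :=
  ∃ A B : Finset V, A.card = t ∧ B.card = t ∧ Disjoint A B ∧
    ∀ a ∈ A, ∀ b ∈ B, G.Adj a b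

/-- A set of vertices is stable (independent) if no two of its members are adjacent. -/
def IsStableSet {V : Type*} (G : SimpleGraph V) (S : Set V) : Prop :=
  ∀ a ∈ S, ∀ b ∈ S, a ≠ b → ¬ G.Adj a b

/-- An `s`-template in `G`: a clique `L0` complete to all the `L i`, pairwise disjoint sets
`L 1, …, L k` (here indexed by `Fin k`) whose sizes lie between `ω^{s+5}` and `14 ω^{s+6}`,
such that each vertex of `L i` has at most `ω^{s+3}` non-neighbours in each other `L j`. -/
def IsTemplate {V : Type*} (G : SimpleGraph V) (s : ℕ) (L0 : Set V) {k : ℕ}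
    (L : Fin k → Set V) : Prop :=
  (∀ i : Fin k, Disjoint L0 (L i)) ∧
  (Pairwise fun i j : Fin k => Disjoint (L i) (L j)) ∧
  G.IsClique L0 ∧
  (∀ u ∈ L0, ∀ i : Fin k, ∀ v ∈ L i, G.Adj u v) ∧
  (∀ i : Fin k, G.cliqueNum ^ (s+5) ≤ (L i).ncard ∧ (L i).ncard ≤ 14 * G.cliqueNum ^ (s+6)) ∧
  (∀ i j : Fin k, i ≠ j → ∀ v ∈ L i,
    ({u ∈ L j | ¬ G.Adj v u}).ncard ≤ G.cliqueNum ^ (s+3))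

/-- The value of an `s`-template. -/
noncomputable def templateValue {V : Type*} (G : SimpleGraph V) (s : ℕ) (L0 : Set V) {k : ℕ}
    (L : Fin k → Set V) : ℕ :=
  (⋃ i, L i).ncard + 7 * G.cliqueNum ^ (s+5) * L0.ncard + k * G.cliqueNum ^ (s+5)

/-- An optimal `s`-template: one of maximum value among all `s`-templates in `G`. -/
def IsOptimalTemplate {V : Type*} (G : SimpleGraph V) (s : ℕ) (L0 : Set V) {k : ℕ}
    (L : Fin k → Set V) : Prop :=
  IsTemplate G s L0 L ∧
  ∀ (k' : ℕ) (L0' : Set V) (L' : Fin k' → Set V), IsTemplate G s L0' L' →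
    templateValue G s L0' L' ≤ templateValue G s L0 L

/-- `V(𝓛)`, the vertex set of a template. -/
def templateVerts {V : Type*} (L0 : Set V) {k : ℕ} (L : Fin k → Set V) : Set V :=
  L0 ∪ ⋃ i, L i

/-- `N(𝓛)`: the vertices outside `V(𝓛)` with a neighbour in `L 1 ∪ ⋯ ∪ L k`. -/
def templateNbhd {V : Type*} (G : SimpleGraph V) (L0 : Set V) {k : ℕ}
    (L : Fin k → Set V) : Set V :=
  {v | v ∉ templateVerts L0 L ∧ ∃ i : Fin k, ∃ u ∈ L i, G.Adj v u}


/-- A vertex `v` is pendant with respect to the template: there are distinct `i, j`, a vertex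
`u ∈ L j` and a stable set `S ⊆ L i` of `s+1` common neighbours of `u` such that `v` is not
adjacent to `u` and `v` has exactly one neighbour in `S`. -/
def TemplatePendant {V : Type*} (G : SimpleGraph V) (s : ℕ) {k : ℕ}
    (L : Fin k → Set V) (v : V) : Prop :=
  ∃ i j : Fin k, i ≠ j ∧ ∃ u ∈ L j, ∃ S : Set V, S ⊆ L i ∧ S.ncard = s + 1 ∧
    IsStableSet G S ∧ (∀ w ∈ S, G.Adj u w) ∧ ¬ G.Adj v u ∧ ({w ∈ S | G.Adj v w}).ncard = 1

/-- A vertex `v` is dense with respect to the template: there are `j` and `u ∈ L j` such that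
for all `i ≠ j`, fewer than `ω^{s+2}/14` vertices of `L i` are adjacent to `u` and not to `v`. -/
def TemplateDense {V : Type*} (G : SimpleGraph V) (s : ℕ) {k : ℕ}
    (L : Fin k → Set V) (v : V) : Prop :=
  ∃ j : Fin k, ∃ u ∈ L j, ∀ i : Fin k, i ≠ j →
    14 * ({w ∈ L i | G.Adj u w ∧ ¬ G.Adj v w}).ncard < G.cliqueNum ^ (s+2)

/-- A vertex `v` is pure with respect to the template: it has no neighbour in at least two of
the sets `L i`, and for each `i`, either it has no neighbour in `L i` or it has at most
`ω^{s+2}/7` non-neighbours in `L i`. -/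
def TemplatePure {V : Type*} (G : SimpleGraph V) (s : ℕ) {k : ℕ}
    (L : Fin k → Set V) (v : V) : Prop :=
  (∃ i₁ i₂ : Fin k, i₁ ≠ i₂ ∧ (∀ w ∈ L i₁, ¬ G.Adj v w) ∧ (∀ w ∈ L i₂, ¬ G.Adj v w)) ∧
  (∀ i : Fin k, (∀ w ∈ L i, ¬ G.Adj v w) ∨
    7 * ({w ∈ L i | ¬ G.Adj v w}).ncard ≤ G.cliqueNum ^ (s+2))

/-- `M_I`: the pure vertices `v` (with respect to the template) whose set `I_v` of indices `i`
such that `v` has a neighbour in `L i` equals `I`. -/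
def templatePart {V : Type*} (G : SimpleGraph V) (s : ℕ) (L0 : Set V) {k : ℕ}
    (L : Fin k → Set V) (I : Set (Fin k)) : Set V :=
  {v | v ∈ templateNbhd G L0 L ∧ TemplatePure G s L v ∧
    ∀ i : Fin k, (∃ u ∈ L i, G.Adj v u) ↔ i ∈ I}

/-- Two disjoint sets `A, B` are `s`-crowded if there is no stable set meeting each of them
in exactly `s` vertices. -/
def SCrowded {V : Type*} (G : SimpleGraph V) (s : ℕ) (A B : Set V) : Prop :=
  ¬ ∃ X : Set V, IsStableSet G X ∧ (X ∩ A).ncard = s ∧ (X ∩ B).ncard = s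

/-- `c` satisfies the Kővári–Sós–Turán-type bound for `H_s`: every `H_s`-free graph either
contains `K_{t,t}` as a subgraph or has degeneracy less than `t^c`. -/
def KSTBound (s c : ℕ) : Prop :=
  ∀ (W : Type) [Fintype W], ∀ G' : SimpleGraph W, IsInducedFree G' (doubleStarGraph s) →
    ∀ t : ℕ, ContainsKtt G' t ∨ ∃ D : ℕ, D < t ^ c ∧ DegeneracyAtMost G' D

/-- `Z(𝓛)`: the union of `L0` with the set of vertices of `N(𝓛)` having at most `ω^{s+2}/4`
non-neighbours in each `L i`. -/
def templateZ {V : Type*} (G : SimpleGraph V) (s : ℕ) (L0 : Set V) {k : ℕ}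
    (L : Fin k → Set V) : Set V :=
  L0 ∪ {v ∈ templateNbhd G L0 L |
    ∀ i : Fin k, 4 * ({u ∈ L i | ¬ G.Adj v u}).ncard ≤ G.cliqueNum ^ (s+2)}

/-- `Y(𝓛) = (V(𝓛) ∪ N(𝓛)) \ Z(𝓛)`. -/
def templateY {V : Type*} (G : SimpleGraph V) (s : ℕ) (L0 : Set V) {k : ℕ}
    (L : Fin k → Set V) : Set V :=
  (templateVerts L0 L ∪ templateNbhd G L0 L) \ templateZ G s L0 L

/-- `N_A(𝓛)`: the vertices of `A \ V(𝓛)` with a neighbour in `L 1 ∪ ⋯ ∪ L k`. -/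
def templateNbhdIn {V : Type*} (G : SimpleGraph V) (A : Set V) (L0 : Set V) {k : ℕ}
    (L : Fin k → Set V) : Set V :=
  {v ∈ A | v ∉ templateVerts L0 L ∧ ∃ i : Fin k, ∃ u ∈ L i, G.Adj v u}

/-- `Z_A(𝓛)`: the union of `L0` with the set of vertices of `A \ V(𝓛)` having at most
`ω^{s+2}/4` non-neighbours in each `L i`. -/
def templateZIn {V : Type*} (G : SimpleGraph V) (s : ℕ) (A : Set V) (L0 : Set V) {k : ℕ}
    (L : Fin k → Set V) : Set V :=
  L0 ∪ {v ∈ A | v ∉ templateVerts L0 L ∧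
    ∀ i : Fin k, 4 * ({u ∈ L i | ¬ G.Adj v u}).ncard ≤ G.cliqueNum ^ (s+2)}

/-- `Y_A(𝓛) = (V(𝓛) ∪ N_A(𝓛)) \ Z_A(𝓛)`. -/
def templateYIn {V : Type*} (G : SimpleGraph V) (s : ℕ) (A : Set V) (L0 : Set V) {k : ℕ}
    (L : Fin k → Set V) : Set V :=
  (templateVerts L0 L ∪ templateNbhdIn G A L0 L) \ templateZIn G s A L0 L

namespace DS
open Classical

/-- non-neighbours of `v` in `X`. -/
noncomputable def nn {V : Type} (G : SimpleGraph V) (v : V) (X : Finset V) : Finset V :=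
  X.filter (fun y => ¬ G.Adj v y)

/-- neighbours of `v` in `X`. -/
noncomputable def nb {V : Type} (G : SimpleGraph V) (v : V) (X : Finset V) : Finset V :=
  X.filter (fun y => G.Adj v y)

def Stab {V : Type} (G : SimpleGraph V) (S : Finset V) : Prop :=
  ∀ a ∈ S, ∀ b ∈ S, ¬ G.Adj a b

/-- no induced double star with `s` leaves on each side. -/
def HF {V : Type} (G : SimpleGraph V) (s : ℕ) : Prop :=
  ∀ x y, G.Adj x y → ∀ S T : Finset V, S.card = s → T.card = s → Stab G S → Stab G T →
    (∀ a ∈ S, G.Adj x a ∧ ¬ G.Adj y a) → (∀ b ∈ T, G.Adj y b ∧ ¬ G.Adj x b) →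
    (∀ a ∈ S, ∀ b ∈ T, ¬ G.Adj a b) → False

/-- cliques are smaller than `w`. -/
def CB {V : Type} (G : SimpleGraph V) (w : ℕ) : Prop :=
  ∀ K : Finset V, G.IsClique (K : Set V) → K.card < w

def Ram {V : Type} (G : SimpleGraph V) (s r : ℕ) : Prop :=
  ∀ X : Finset V, r ≤ X.card → ∃ S ⊆ X, S.card = s ∧ Stab G S

variable {V : Type} {G : SimpleGraph V}

lemma mem_nn {v y : V} {X : Finset V} : y ∈ nn G v X ↔ y ∈ X ∧ ¬ G.Adj v y := by
  simp [nn]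

lemma mem_nb {v y : V} {X : Finset V} : y ∈ nb G v X ↔ y ∈ X ∧ G.Adj v y := by
  simp [nb]

lemma nb_add_nn (v : V) (X : Finset V) : (nb G v X).card + (nn G v X).card = X.card := by
  unfold nb nn
  exact Finset.card_filter_add_card_filter_not _

lemma nn_sub {v : V} {X : Finset V} : nn G v X ⊆ X := Finset.filter_subset _ _
lemma nb_sub {v : V} {X : Finset V} : nb G v X ⊆ X := Finset.filter_subset _ _

lemma nn_mono {v : V} {X Y : Finset V} (h : X ⊆ Y) : nn G v X ⊆ nn G v Y :=
  Finset.filter_subset_filter _ h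
lemma nb_mono {v : V} {X Y : Finset V} (h : X ⊆ Y) : nb G v X ⊆ nb G v Y :=
  Finset.filter_subset_filter _ h

/-- common neighbour. -/
lemma common_nb {K X : Finset V} {t : ℕ} (h : ∀ k ∈ K, (nn G k X).card ≤ t)
    (hc : K.card * t < X.card) : ∃ x ∈ X, ∀ k ∈ K, G.Adj k x := by
  by_contra hcon
  push Not at hcon
  have : X ⊆ K.biUnion (fun k => nn G k X) := by
    intro x hx
    obtain ⟨k, hk, hkx⟩ := hcon x hx
    exact Finset.mem_biUnion.2 ⟨k, hk, mem_nn.2 ⟨hx, hkx⟩⟩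
  have h2 := (Finset.card_le_card this).trans (Finset.card_biUnion_le_card_mul _ _ t h)
  omega

lemma clique_insert {K : Finset V} (hK : G.IsClique (K : Set V)) {x : V}
    (hx : ∀ k ∈ K, G.Adj k x) :
    G.IsClique ((insert x K : Finset V) : Set V) ∧ (insert x K).card = K.card + 1 := by
  constructor
  · rw [Finset.coe_insert, SimpleGraph.isClique_insert]
    exact ⟨hK, fun b hb _ => (hx b hb).symm⟩
  · apply Finset.card_insert_of_notMem
    intro h
    exact G.loopless.irrefl _ (hx x h)

/-- greedy transversal clique. -/
lemma greedy {ι : Type} (I : Finset ι) (L : ι → Finset V) (t : ℕ) (c : ℕ)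
    (hc : I.card ≤ c)
    (hn : ∀ i ∈ I, ∀ j ∈ I, i ≠ j → ∀ x ∈ L i, (nn G x (L j)).card ≤ t)
    (hs : ∀ i ∈ I, c * t < (L i).card) :
    ∃ K : Finset V, G.IsClique (K : Set V) ∧ K.card = I.card ∧ ∀ x ∈ K, ∃ i ∈ I, x ∈ L i := by
  induction I using Finset.induction_on with
  | empty => exact ⟨∅, by simp, by simp, by simp⟩
  | insert i J hi ih =>
    rw [Finset.card_insert_of_notMem hi] at hc
    obtain ⟨K, hK, hKc, hKL⟩ := ih (by omega)
      (fun a ha b hb => hn a (Finset.mem_insert_of_mem ha) b (Finset.mem_insert_of_mem hb))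
      (fun a ha => hs a (Finset.mem_insert_of_mem ha))
    have h1 : ∀ k ∈ K, (nn G k (L i)).card ≤ t := by
      intro k hk
      obtain ⟨j, hj, hkj⟩ := hKL k hk
      exact hn j (Finset.mem_insert_of_mem hj) i (Finset.mem_insert_self _ _)
        (fun h => hi (h ▸ hj)) k hkj
    have h2 : K.card * t < (L i).card :=
      lt_of_le_of_lt (Nat.mul_le_mul_right t (by omega)) (hs i (Finset.mem_insert_self _ _))
    obtain ⟨x, hx, hxK⟩ := common_nb h1 h2
    obtain ⟨h3, h4⟩ := clique_insert hK hxK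
    refine ⟨insert x K, h3, by rw [h4, hKc, Finset.card_insert_of_notMem hi], ?_⟩
    intro y hy
    rcases Finset.mem_insert.1 hy with rfl | hy
    · exact ⟨i, Finset.mem_insert_self _ _, hx⟩
    · obtain ⟨j, hj, h⟩ := hKL y hy
      exact ⟨j, Finset.mem_insert_of_mem hj, h⟩

/-- Ramsey. -/
lemma ramsey {w : ℕ} (hw : CB G w) (s : ℕ) : Ram G s (w ^ s) := by
  induction s with
  | zero => intro X _; exact ⟨∅, by simp, by simp, by simp [Stab]⟩
  | succ s ih =>
    intro X hX
    by_contra hcon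
    have hw1 : 0 < w := by have := hw ∅ (by simp); simpa using this
    -- every vertex has few non-neighbours
    have h1 : ∀ x ∈ X, (nn G x X).card ≤ w ^ s := by
      intro x hx
      by_contra hlt
      push Not at hlt
      have : w ^ s ≤ ((nn G x X).erase x).card := by
        have := Finset.pred_card_le_card_erase (s := nn G x X) (a := x); omega
      obtain ⟨S, hS, hSc, hSs⟩ := ih _ this
      have hxS : x ∉ S := fun h => by simpa using hS h
      apply hcon
      refine ⟨insert x S, ?_, by rw [Finset.card_insert_of_notMem hxS, hSc], ?_⟩
      · intro y hy
        rcases Finset.mem_insert.1 hy with rfl | hy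
        · exact hx
        · exact nn_sub (Finset.erase_subset _ _ (hS hy))
      · have hxS' : ∀ y ∈ S, ¬ G.Adj x y := fun y hy =>
          (mem_nn.1 (Finset.erase_subset _ _ (hS hy))).2
        intro a ha b hb
        rcases Finset.mem_insert.1 ha with ha' | ha' <;>
          rcases Finset.mem_insert.1 hb with hb' | hb'
        · rw [ha', hb']; exact G.loopless.irrefl _
        · rw [ha']; exact hxS' b hb'
        · rw [hb']; exact fun h => hxS' a ha' h.symm
        · exact hSs a ha' b hb'
    -- a maximal clique
    have h2 : ∀ c, c ≤ w → ∃ K ⊆ X, G.IsClique (K : Set V) ∧ K.card = c := by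
      intro c
      induction c with
      | zero => intro _; exact ⟨∅, by simp, by simp, by simp⟩
      | succ c ihc =>
        intro hc
        obtain ⟨K, hKX, hK, hKc⟩ := ihc (by omega)
        have : K.card * w ^ s < X.card := by
          refine lt_of_lt_of_le ?_ hX
          rw [hKc, pow_succ, mul_comm (w ^ s)]
          exact Nat.mul_lt_mul_of_pos_right (by omega) (by positivity)
        obtain ⟨x, hx, hxK⟩ := common_nb (fun k hk => h1 k (hKX hk)) this
        obtain ⟨h3, h4⟩ := clique_insert hK hxK
        exact ⟨insert x K, Finset.insert_subset hx hKX, h3, by omega⟩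
    obtain ⟨K, _, hK, hKc⟩ := h2 w le_rfl
    have := hw K hK
    omega

lemma HF_big {s r : ℕ} (hH : HF G s) (hR : Ram G s r) {x y : V} (hxy : G.Adj x y)
    {X Y : Finset V} (hX : ∀ a ∈ X, G.Adj x a ∧ ¬ G.Adj y a)
    (hY : ∀ b ∈ Y, G.Adj y b ∧ ¬ G.Adj x b) (hXY : ∀ a ∈ X, ∀ b ∈ Y, ¬ G.Adj a b)
    (hXr : r ≤ X.card) : Y.card < r := by
  by_contra h
  push Not at h
  obtain ⟨S, hS, hSc, hSs⟩ := hR X hXr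
  obtain ⟨T, hT, hTc, hTs⟩ := hR Y h
  exact hH x y hxy S T hSc hTc hSs hTs (fun a ha => hX a (hS ha)) (fun a ha => hY a (hT ha))
    (fun a ha b hb => hXY a (hS ha) b (hT hb))

/-- Double counting of non-edges. -/
lemma nn_sum_comm (X Y : Finset V) :
    ∑ x ∈ X, (nn G x Y).card = ∑ y ∈ Y, (nn G y X).card := by
  unfold nn
  simp_rw [Finset.card_filter]
  rw [Finset.sum_comm]
  simp_rw [G.adj_comm]

/-- number of vertices with more than `m` non-neighbours. -/
lemma bad_mul_le (X Y : Finset V) (m : ℕ) :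
    (X.filter (fun x => m ≤ (nn G x Y).card)).card * m ≤ ∑ x ∈ X, (nn G x Y).card := by
  calc _ = ∑ x ∈ X.filter (fun x => m ≤ (nn G x Y).card), m := by simp
    _ ≤ ∑ x ∈ X.filter (fun x => m ≤ (nn G x Y).card), (nn G x Y).card :=
        Finset.sum_le_sum (fun x hx => (Finset.mem_filter.1 hx).2)
    _ ≤ _ := Finset.sum_le_sum_of_subset (Finset.filter_subset _ _)

/-- supersaturation of stable sets. -/
lemma supersat {s r : ℕ} (hR : Ram G s r) (hsr : s ≤ r) (A : Finset V) (hA : r ≤ A.card) :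
    A.card.choose s ≤ ((A.powersetCard s).filter (fun S => Stab G S)).card * r.choose s := by
  set F := (A.powersetCard s).filter (fun S => Stab G S) with hF
  have h1 : A.card.choose r ≤ F.card * (A.card - s).choose (r - s) := by
    rw [← Finset.card_powersetCard]
    have hsub : A.powersetCard r ⊆
        F.biUnion (fun S => (A.powersetCard r).filter (fun R => S ⊆ R)) := by
      intro R hRm
      have hRm' := Finset.mem_powersetCard.1 hRm
      obtain ⟨S, hS, hSc, hSs⟩ := hR R hRm'.2.ge
      refine Finset.mem_biUnion.2 ⟨S, ?_, Finset.mem_filter.2 ⟨hRm, hS⟩⟩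
      exact Finset.mem_filter.2 ⟨Finset.mem_powersetCard.2 ⟨hS.trans hRm'.1, hSc⟩, hSs⟩
    refine (Finset.card_le_card hsub).trans (Finset.card_biUnion_le_card_mul _ _ _ ?_)
    intro S hS
    have hS' := Finset.mem_powersetCard.1 (Finset.mem_filter.1 hS).1
    have : ((A \ S).powersetCard (r - s)).card = (A.card - s).choose (r - s) := by
      rw [Finset.card_powersetCard, Finset.card_sdiff_of_subset hS'.1, hS'.2]
    rw [← this]
    apply Finset.card_le_card_of_injOn (fun R => R \ S)
    · intro R hR
      have hR := Finset.mem_filter.1 hR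
      have hR1 := Finset.mem_powersetCard.1 hR.1
      refine Finset.mem_coe.2 (Finset.mem_powersetCard.2 ⟨Finset.sdiff_subset_sdiff hR1.1 le_rfl, ?_⟩)
      rw [Finset.card_sdiff_of_subset hR.2, hR1.2, hS'.2]
    · intro R hR R' hR' heq
      have hR := (Finset.mem_filter.1 hR).2
      have hR' := (Finset.mem_filter.1 hR').2
      simp only at heq
      rw [← Finset.sdiff_union_of_subset hR, heq, Finset.sdiff_union_of_subset hR']
  have h2 := Nat.choose_mul (n := A.card) (k := r) (s := s) hsr
  have h3 : 0 < (A.card - s).choose (r - s) := Nat.choose_pos (by omega)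
  refine Nat.le_of_mul_le_mul_right ?_ h3
  rw [← h2]
  calc _ ≤ F.card * (A.card - s).choose (r - s) * r.choose s := Nat.mul_le_mul_right _ h1
    _ = _ := by ring

/-- crowding lemma. -/
lemma crowd {s r a M ν : ℕ} (hH : HF G s) (hR : Ram G s r) (hsr : s ≤ r) (hra : r ≤ a)
    (hν : 2 * (M * a) ≤ ν) (hbig : r * r ^ s * M ^ s < a * (a + 1 - s) ^ s)
    {x y : V} (hxy : G.Adj x y) {X Y : Finset V} (hXM : X.card ≤ M) (hYM : Y.card ≤ M)
    (hX : ∀ a ∈ X, G.Adj x a ∧ ¬ G.Adj y a) (hY : ∀ b ∈ Y, G.Adj y b ∧ ¬ G.Adj x b) :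
    ∑ b ∈ Y, (nn G b X).card ≤ ν := by
  by_contra hcon
  push Not at hcon
  set B := Y.filter (fun b => a ≤ (nn G b X).card) with hB
  have hBa : a ≤ B.card := by
    by_contra hlt
    push Not at hlt
    have : ∑ b ∈ Y, (nn G b X).card ≤ ∑ b ∈ B, M + ∑ b ∈ Y, a := by
      rw [← Finset.sum_filter_add_sum_filter_not Y (fun b => a ≤ (nn G b X).card)]
      apply Nat.add_le_add
      · exact Finset.sum_le_sum (fun b _ => (Finset.card_le_card nn_sub).trans hXM)
      · refine (Finset.sum_le_sum (g := fun _ => a) ?_).trans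
          (Finset.sum_le_sum_of_subset (Finset.filter_subset _ _))
        intro b hb
        have := (Finset.mem_filter.1 hb).2
        omega
    simp only [Finset.sum_const, smul_eq_mul] at this
    have h1 : B.card * M ≤ M * a := by rw [mul_comm M]; exact Nat.mul_le_mul_right _ hlt.le
    have h2 : Y.card * a ≤ M * a := Nat.mul_le_mul_right _ hYM
    omega
  set St := (X.powersetCard s).filter (fun S => Stab G S) with hSt
  have key : ∑ b ∈ B, (St.filter (fun S => S ⊆ nn G b X)).card
      = ∑ S ∈ St, (B.filter (fun b => S ⊆ nn G b X)).card := by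
    simp_rw [Finset.card_filter]
    rw [Finset.sum_comm]
  have up : ∑ S ∈ St, (B.filter (fun b => S ⊆ nn G b X)).card ≤ M.choose s * r := by
    calc _ ≤ ∑ S ∈ St, r := by
          refine Finset.sum_le_sum ?_
          intro S hS
          by_contra hlt
          push Not at hlt
          obtain ⟨T, hT, hTc, hTs⟩ := hR _ hlt.le
          have hS1 := Finset.mem_filter.1 hS
          have hS2 := Finset.mem_powersetCard.1 hS1.1
          refine hH x y hxy S T hS2.2 hTc hS1.2 hTs (fun c hc => hX c (hS2.1 hc)) ?_ ?_
          · intro b hb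
            exact hY b (Finset.mem_filter.1 (Finset.mem_filter.1 (hT hb)).1).1
          · intro c hc b hb h
            exact (mem_nn.1 ((Finset.mem_filter.1 (hT hb)).2 hc)).2 h.symm
      _ = St.card * r := by simp
      _ ≤ _ := by
          refine Nat.mul_le_mul_right _ ((Finset.card_filter_le _ _).trans ?_)
          rw [Finset.card_powersetCard]
          exact Nat.choose_le_choose s hXM
  have low : a * a.choose s ≤ (∑ b ∈ B, (St.filter (fun S => S ⊆ nn G b X)).card) * r.choose s := by
    rw [Finset.sum_mul]
    calc a * a.choose s ≤ B.card * a.choose s := Nat.mul_le_mul_right _ hBa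
      _ = ∑ b ∈ B, a.choose s := by simp
      _ ≤ _ := by
        refine Finset.sum_le_sum ?_
        intro b hb
        have hb2 := (Finset.mem_filter.1 hb).2
        refine (Nat.choose_le_choose s hb2).trans ((supersat hR hsr _ (hra.trans hb2)).trans ?_)
        refine Nat.mul_le_mul_right _ (Finset.card_le_card ?_)
        intro S hS
        have hS1 := Finset.mem_filter.1 hS
        have hS2 := Finset.mem_powersetCard.1 hS1.1
        refine Finset.mem_filter.2 ⟨Finset.mem_filter.2 ⟨Finset.mem_powersetCard.2
          ⟨hS2.1.trans nn_sub, hS2.2⟩, hS1.2⟩, hS2.1⟩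
  rw [key] at low
  have h5 : a * a.choose s ≤ M.choose s * r * r.choose s := low.trans (Nat.mul_le_mul_right _ up)
  have h6 : (a + 1 - s) ^ s ≤ s.factorial * a.choose s := by
    rw [← Nat.descFactorial_eq_factorial_mul_choose]; exact Nat.pow_sub_le_descFactorial a s
  have h7 : s.factorial * M.choose s ≤ M ^ s := by
    rw [← Nat.descFactorial_eq_factorial_mul_choose]; exact Nat.descFactorial_le_pow M s
  have h8 : r.choose s ≤ r ^ s := Nat.choose_le_pow r s
  have : a * (a + 1 - s) ^ s ≤ r * r ^ s * M ^ s := by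
    calc a * (a + 1 - s) ^ s ≤ a * (s.factorial * a.choose s) := Nat.mul_le_mul_left _ h6
      _ = s.factorial * (a * a.choose s) := by ring
      _ ≤ s.factorial * (M.choose s * r * r.choose s) := Nat.mul_le_mul_left _ h5
      _ = r * r.choose s * (s.factorial * M.choose s) := by ring
      _ ≤ _ := Nat.mul_le_mul (Nat.mul_le_mul_left _ h8) h7
  omega

end DS

namespace DS
open Classical
variable {V : Type} {G : SimpleGraph V}

/-- every nonempty subset of `A` has a vertex of small degree. -/
def Degen (G : SimpleGraph V) (A : Finset V) (d : ℕ) : Prop :=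
  ∀ C ⊆ A, C.Nonempty → ∃ v ∈ C, (nb G v C).card ≤ d

/-- `A` is partitioned into `K` parts of degeneracy at most `d`. -/
def Col (G : SimpleGraph V) (A : Finset V) (K d : ℕ) : Prop :=
  ∃ f : V → ℕ, (∀ v ∈ A, f v < K) ∧ ∀ c, Degen G (A.filter (fun v => f v = c)) d

lemma Degen.mono {A B : Finset V} {d e : ℕ} (h : Degen G B d) (hAB : A ⊆ B) (hde : d ≤ e) :
    Degen G A e := by
  intro C hC hne
  obtain ⟨v, hv, h1⟩ := h C (hC.trans hAB) hne
  exact ⟨v, hv, h1.trans hde⟩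

lemma degen_card (A : Finset V) : Degen G A A.card := by
  rintro C hC ⟨v, hv⟩
  exact ⟨v, hv, Finset.card_le_card (nb_sub.trans hC)⟩

/-- combining: vertices of `A` have few neighbours in `B`. -/
lemma Degen.union {A B : Finset V} {d e r : ℕ} (hA : Degen G A d) (hB : Degen G B e)
    (hde : d + r ≤ e) (hr : ∀ v ∈ A, (nb G v B).card ≤ r) : Degen G (A ∪ B) e := by
  intro C hC hne
  by_cases h : (C ∩ A).Nonempty
  · obtain ⟨v, hv, h1⟩ := hA (C ∩ A) Finset.inter_subset_right h
    refine ⟨v, (Finset.mem_inter.1 hv).1, ?_⟩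
    have : nb G v C ⊆ nb G v (C ∩ A) ∪ nb G v B := by
      intro x hx
      rw [mem_nb] at hx
      rcases Finset.mem_union.1 (hC hx.1) with h2 | h2
      · exact Finset.mem_union_left _ (mem_nb.2 ⟨Finset.mem_inter.2 ⟨hx.1, h2⟩, hx.2⟩)
      · exact Finset.mem_union_right _ (mem_nb.2 ⟨h2, hx.2⟩)
    have h3 := (Finset.card_le_card this).trans (Finset.card_union_le _ _)
    have h4 := hr v (Finset.mem_inter.1 hv).2
    omega
  · apply hB C _ hne
    intro x hx
    rcases Finset.mem_union.1 (hC hx) with h2 | h2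
    · exact absurd ⟨x, Finset.mem_inter.2 ⟨hx, h2⟩⟩ h
    · exact h2

lemma Col.mono {A B : Finset V} {K K' d e : ℕ} (h : Col G B K d) (hAB : A ⊆ B) (hK : K ≤ K')
    (hde : d ≤ e) : Col G A K' e := by
  obtain ⟨f, h1, h2⟩ := h
  exact ⟨f, fun v hv => (h1 v (hAB hv)).trans_le hK,
    fun c => (h2 c).mono (Finset.filter_subset_filter _ hAB) hde⟩

lemma Col.of_degen {A : Finset V} {d : ℕ} (h : Degen G A d) : Col G A 1 d :=
  ⟨fun _ => 0, by simp, fun _ => h.mono (Finset.filter_subset _ _) le_rfl⟩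

lemma Col.empty (d : ℕ) : Col G ∅ 0 d :=
  ⟨fun _ => 0, by simp, fun c => by
    intro C hC hne
    simp only [Finset.filter_empty, Finset.subset_empty] at hC
    simp [hC] at hne⟩

lemma Col.union {A B : Finset V} {K K' d : ℕ} (hA : Col G A K d) (hB : Col G B K' d) :
    Col G (A ∪ B) (K + K') d := by
  obtain ⟨f, f1, f2⟩ := hA
  obtain ⟨g, g1, g2⟩ := hB
  refine ⟨fun v => if v ∈ A then f v else K + g v, ?_, ?_⟩
  · intro v hv
    by_cases h : v ∈ A
    · simp only [h, if_true]; have := f1 v h; omega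
    · have hvB : v ∈ B := by
        rcases Finset.mem_union.1 hv with h' | h'
        · exact absurd h' h
        · exact h'
      simp only [h, if_false]; have := g1 v hvB; omega
  · intro c
    by_cases hc : c < K
    · refine (f2 c).mono ?_ le_rfl
      intro v hv
      rw [Finset.mem_filter] at hv ⊢
      by_cases h : v ∈ A
      · simp only [h, if_true] at hv; exact ⟨h, hv.2⟩
      · simp only [h, if_false] at hv; omega
    · refine (g2 (c - K)).mono ?_ le_rfl
      intro v hv
      rw [Finset.mem_filter] at hv ⊢
      by_cases h : v ∈ A
      · simp only [h, if_true] at hv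
        have := f1 v h; omega
      · simp only [h, if_false, Finset.mem_union, false_or] at hv
        exact ⟨hv.1, by omega⟩

lemma Col.biUnion {ι : Type} (I : Finset ι) (D : ι → Finset V) (d : ℕ)
    (h : ∀ i ∈ I, Degen G (D i) d) : Col G (I.biUnion D) I.card d := by
  induction I using Finset.induction_on with
  | empty => simpa using Col.empty d
  | insert i J hi ih =>
    rw [Finset.biUnion_insert, Finset.card_insert_of_notMem hi, add_comm]
    exact (Col.of_degen (h i (Finset.mem_insert_self _ _))).union
      (ih (fun j hj => h j (Finset.mem_insert_of_mem hj)))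

lemma Col.of_fin {γ : Type} {A : Finset V} {K d : ℕ} (Γ : Finset γ) (f : V → γ)
    (hf : ∀ v ∈ A, f v ∈ Γ) (h : ∀ c ∈ Γ, ∀ C ⊆ A, (∀ v ∈ C, f v = c) → C.Nonempty →
      ∃ v ∈ C, (nb G v C).card ≤ d)
    (hK : Γ.card ≤ K) : Col G A K d := by
  let e := Γ.equivFin
  refine ⟨fun v => if hv : f v ∈ Γ then (e ⟨f v, hv⟩ : ℕ) else K, ?_, ?_⟩
  · intro v hv
    simp only [hf v hv, dif_pos]
    exact (e _).2.trans_le hK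
  · intro c C hC hne
    obtain ⟨x, hx⟩ := hne
    have hx1 := Finset.mem_filter.1 (hC hx)
    have hxΓ := hf x hx1.1
    refine h (f x) hxΓ C (hC.trans (Finset.filter_subset _ _)) ?_ ⟨x, hx⟩
    intro y hy
    have hy1 := Finset.mem_filter.1 (hC hy)
    have hyΓ := hf y hy1.1
    have h1 := hx1.2
    have h2 := hy1.2
    simp only [hxΓ, hyΓ, dif_pos] at h1 h2
    have h3 := e.injective (Fin.ext (h2.trans h1.symm))
    exact congrArg Subtype.val h3

lemma Col.to_fin {γ : Type} {A : Finset V} {K d : ℕ} (h : Col G A K d) (Γ : Finset γ)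
    (hK : K ≤ Γ.card) (hne : Γ.Nonempty) :
    ∃ f : V → γ, (∀ v ∈ A, f v ∈ Γ) ∧ ∀ c, ∀ C ⊆ A, (∀ v ∈ C, f v = c) → C.Nonempty →
      ∃ v ∈ C, (nb G v C).card ≤ d := by
  obtain ⟨f, h1, h2⟩ := h
  obtain ⟨g0, hg0⟩ := hne
  let e := Γ.equivFin
  refine ⟨fun v => if hv : f v < Γ.card then (e.symm ⟨f v, hv⟩ : γ) else g0, ?_, ?_⟩
  · intro v hv
    simp only [(h1 v hv).trans_le hK, dif_pos]
    exact (e.symm _).2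
  · intro c C hC hCc hne
    obtain ⟨x, hx⟩ := hne
    refine h2 (f x) C ?_ ⟨x, hx⟩
    intro y hy
    have hx1 : x ∈ A ∧ _ := ⟨hC hx, hCc x hx⟩
    have hy1 : y ∈ A ∧ _ := ⟨hC hy, hCc y hy⟩
    refine Finset.mem_filter.2 ⟨hy1.1, ?_⟩
    have h3 := hx1.2
    have h4 := hy1.2
    simp only [(h1 x hx1.1).trans_le hK, (h1 y hy1.1).trans_le hK, dif_pos] at h3 h4
    have h5 := e.symm.injective (Subtype.ext (h4.trans h3.symm))
    exact congrArg Fin.val h5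

/-- combination of colourings over the same palette. -/
lemma Col.join {A B : Finset V} {K d e r : ℕ} (hA : Col G A K d) (hB : Col G B K e)
    (hde : d + r ≤ e) (hr : ∀ v ∈ A, (nb G v B).card ≤ r) : Col G (A ∪ B) K e := by
  obtain ⟨f, f1, f2⟩ := hA
  obtain ⟨g, g1, g2⟩ := hB
  refine ⟨fun v => if v ∈ A then f v else g v, ?_, ?_⟩
  · intro v hv
    by_cases h : v ∈ A
    · simp only [h, if_true]; exact f1 v h
    · have hvB : v ∈ B := by
        rcases Finset.mem_union.1 hv with h' | h'
        · exact absurd h' h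
        · exact h'
      simp only [h, if_false]; exact g1 v hvB
  · intro c
    refine ((f2 c).union (g2 c) hde ?_).mono ?_ le_rfl
    · intro v hv
      exact (Finset.card_le_card (nb_mono (Finset.filter_subset _ _))).trans
        (hr v (Finset.mem_filter.1 hv).1)
    · intro v hv
      rw [Finset.mem_filter] at hv
      by_cases h : v ∈ A
      · simp only [h, if_true] at hv
        exact Finset.mem_union_left _ (Finset.mem_filter.2 ⟨h, hv.2⟩)
      · simp only [h, if_false, Finset.mem_union, false_or] at hv
        exact Finset.mem_union_right _ (Finset.mem_filter.2 hv)

/-- degenerate sets can be properly coloured. -/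
lemma Degen.color {A : Finset V} {d : ℕ} (h : Degen G A d) :
    ∃ f : V → ℕ, (∀ v ∈ A, f v < d + 1) ∧ ∀ u ∈ A, ∀ v ∈ A, G.Adj u v → f u ≠ f v := by
  induction hn : A.card generalizing A with
  | zero =>
    rw [Finset.card_eq_zero] at hn
    subst hn
    exact ⟨fun _ => 0, by simp, by simp⟩
  | succ n ih =>
    have hne : A.Nonempty := by rw [← Finset.card_pos]; omega
    obtain ⟨v, hv, hd⟩ := h A le_rfl hne
    obtain ⟨f, f1, f2⟩ := ih (A := A.erase v) (h.mono (Finset.erase_subset _ _) le_rfl)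
      (by rw [Finset.card_erase_of_mem hv]; omega)
    have : ∃ c ∈ Finset.range (d + 1), c ∉ (nb G v A).image f := by
      by_contra hcon
      push Not at hcon
      have h1 := Finset.card_le_card (show Finset.range (d+1) ⊆ (nb G v A).image f from hcon)
      have h2 := Finset.card_image_le (s := nb G v A) (f := f)
      rw [Finset.card_range] at h1
      omega
    obtain ⟨c, hc, hcn⟩ := this
    have hcn' : ∀ u ∈ A, G.Adj v u → f u ≠ c := by
      intro u hu huv he
      exact hcn (Finset.mem_image.2 ⟨u, mem_nb.2 ⟨hu, huv⟩, he⟩)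
    refine ⟨Function.update f v c, ?_, ?_⟩
    · intro u hu
      by_cases huv : u = v
      · subst huv; simpa using hc
      · rw [Function.update_of_ne huv]; exact f1 u (Finset.mem_erase.2 ⟨huv, hu⟩)
    · intro a ha b hb hab
      by_cases hav : a = v
      · subst hav
        have hba : b ≠ a := hab.ne'
        rw [Function.update_self, Function.update_of_ne hba]
        exact (hcn' b hb hab).symm
      · by_cases hbv : b = v
        · subst hbv
          rw [Function.update_self, Function.update_of_ne hav]
          exact hcn' a ha hab.symm
        · rw [Function.update_of_ne hav, Function.update_of_ne hbv]
          exact f2 a (Finset.mem_erase.2 ⟨hav, ha⟩) b (Finset.mem_erase.2 ⟨hbv, hb⟩) hab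

lemma Col.colorable [Fintype V] {K d : ℕ} (h : Col G Finset.univ K d) :
    G.Colorable (K * (d + 1)) := by
  obtain ⟨f, f1, f2⟩ := h
  choose g g1 g2 using fun c => (f2 c).color
  let F : V → Fin K × Fin (d+1) := fun v =>
    (⟨f v, f1 v (Finset.mem_univ _)⟩, ⟨g (f v) v, g1 (f v) v (by simp)⟩)
  have C : G.Coloring (Fin K × Fin (d+1)) := SimpleGraph.Coloring.mk F (by
    intro a b hab he
    simp only [F, Prod.mk.injEq, Fin.mk.injEq] at he
    have := g2 (f a) a (by simp) b (by simp [he.1]) hab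
    apply this
    rw [he.2, he.1])
  have := C.colorable
  simpa [Fintype.card_prod] using this

end DS

namespace DS
open Classical

/-- the numerical parameters of the proof. -/
structure Par where
  s : ℕ
  w : ℕ
  r : ℕ
  N : ℕ
  n : ℕ
  m : ℕ
  ν : ℕ
  a : ℕ
  q : ℕ
  q0 : ℕ
  n0 : ℕ
  l : ℕ
  l1 : ℕ
  t : ℕ
  bb : ℕ
  h : ℕ
  E1 : ℕ
  EM : ℕ
  w2 : 2 ≤ w
  s1 : 1 ≤ s
  r1 : 1 ≤ r
  sr : s ≤ r
  ra : r ≤ a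
  hν : 2 * (2 * N * a) ≤ ν
  big : r * r ^ s * (2 * N) ^ s < a * (a + 1 - s) ^ s
  wmn : w * m < n
  νmN : ν < (m + 1) * N
  nN : n ≤ N
  rm : r ≤ m
  qm : 2 * q ≤ m
  hbb : w * (N * (2 * q)) ≤ m * bb
  hEM : w * n + w * bb ≤ EM
  hl : l1 + w * m + w * n + w * n0 < l
  m1 : 2 * m < l1
  hC : w * (N * N * ν) < q0 * q0 * ((l1 - 2 * m) * (l1 - 2 * m))
  hq0m : q0 ≤ m
  hq0 : 1 ≤ q0
  ht : N * r < q0 * (t + 1)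
  hn0 : 2 * q0 + t < n0
  hnl : n + 2 * q0 + 2 * t + r ≤ l1
  hwq : w * q + q0 < l1
  rq0 : r + 2 * q0 ≤ q
  rql : r + q + q0 ≤ l1
  hE1 : w * n0 + w * l + w * q0 ≤ E1
  hh : 1 ≤ h
  hhN : h + E1 + EM < N
  hδ : w * (w * (E1 + EM)) ≤ N

variable {V : Type} {G : SimpleGraph V} (P : Par)

/-- templates. -/
structure Tpl (G : SimpleGraph V) (P : Par) (A : Finset V) {ι : Type} (I : Finset ι)
    (L : ι → Finset V) : Prop where
  sub : ∀ i ∈ I, L i ⊆ A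
  lo : ∀ i ∈ I, P.n ≤ (L i).card
  hi : ∀ i ∈ I, (L i).card ≤ P.N
  near : ∀ i ∈ I, ∀ j ∈ I, i ≠ j → ∀ x ∈ L i, (nn G x (L j)).card ≤ P.m

/-- every template in `A` has total size at most `K`. -/
def CoreLe (G : SimpleGraph V) (P : Par) (A : Finset V) (K : ℕ) : Prop :=
  ∀ (ι : Type) (I : Finset ι) (L : ι → Finset V), Tpl G P A I L → ∑ i ∈ I, (L i).card ≤ K

lemma CoreLe.mono {A B : Finset V} {K : ℕ} (h : CoreLe G P B K) (hAB : A ⊆ B) :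
    CoreLe G P A K := fun ι I L hT =>
  h ι I L ⟨fun i hi => (hT.sub i hi).trans hAB, hT.lo, hT.hi, hT.near⟩

variable {P}

lemma Tpl.card_lt (hw : CB G P.w) {A : Finset V} {ι : Type} {I : Finset ι}
    {L : ι → Finset V} (hT : Tpl G P A I L) : I.card < P.w := by
  by_contra hcon
  push Not at hcon
  obtain ⟨J, hJ, hJc⟩ := Finset.exists_subset_card_eq hcon
  obtain ⟨K, hK, hKc, -⟩ := greedy (G := G) J L P.m P.w hJc.le
    (fun i hi j hj => hT.near i (hJ hi) j (hJ hj))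
    (fun i hi => P.wmn.trans_le (hT.lo i (hJ hi)))
  have := hw K hK
  omega

/-- few vertices of `X` have more than `m` non-neighbours in `Y`. -/
lemma prune {X Y : Finset V} {m ν t : ℕ} (hsum : ∑ x ∈ X, (nn G x Y).card ≤ ν)
    (hν : ν < (m + 1) * t) : (X.filter (fun x => m + 1 ≤ (nn G x Y).card)).card < t := by
  have h1 := bad_mul_le (G := G) X Y (m + 1)
  by_contra hcon
  push Not at hcon
  have h2 := Nat.mul_le_mul_right (m + 1) hcon
  have h3 : (m + 1) * t = t * (m + 1) := mul_comm _ _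
  omega

lemma prune' {X Y : Finset V} {m ν t : ℕ} (hsum : ∑ x ∈ X, (nn G x Y).card ≤ ν)
    (hν : ν < (m + 1) * t) : X.card < (X.filter (fun x => (nn G x Y).card ≤ m)).card + t := by
  have h1 := prune hsum hν
  have h2 := Finset.card_filter_add_card_filter_not (s := X) (fun x => m + 1 ≤ (nn G x Y).card)
  have h3 : X.filter (fun x => ¬ (m + 1 ≤ (nn G x Y).card))
      = X.filter (fun x => (nn G x Y).card ≤ m) := by
    apply Finset.filter_congr
    intro x _
    omega
  rw [h3] at h2
  omega

/-- Kővári–Sós–Turán type lemma. -/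
lemma kst (hH : HF G P.s) (hR : Ram G P.s P.r) (hw : CB G P.w) {A : Finset V}
    (hA : CoreLe G P A (2 * P.N - 1)) : Degen G A (P.w * (2 * P.N)) := by
  intro C hCA hne
  by_contra hcon
  push Not at hcon
  obtain ⟨v, hv, hmin⟩ := Finset.exists_min_image C (fun v => (nb G v C).card) hne
  by_cases hu : ∃ u ∈ nb G v C, 2 * P.N ≤ (nn G u (nb G v C)).card
  · obtain ⟨u, hu, hX⟩ := hu
    rw [mem_nb] at hu
    have e1 := nb_add_nn (G := G) u (nb G v C)
    have e2 := nb_add_nn (G := G) v (nb G u C)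
    have e3 : nb G u (nb G v C) = nb G v (nb G u C) := by
      ext x; simp only [mem_nb]; tauto
    have e4 := hmin u hu.1
    rw [e3] at e1
    have hX' : 2 * P.N ≤ (nn G v (nb G u C)).card := by
      omega
    obtain ⟨X, hXs, hXc⟩ := Finset.exists_subset_card_eq hX
    obtain ⟨Y, hYs, hYc⟩ := Finset.exists_subset_card_eq hX'
    have hXm : ∀ x ∈ X, x ∈ C ∧ G.Adj v x ∧ ¬ G.Adj u x := by
      intro x hx
      have := hXs hx
      simp only [mem_nn, mem_nb] at this
      tauto
    have hYm : ∀ x ∈ Y, x ∈ C ∧ G.Adj u x ∧ ¬ G.Adj v x := by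
      intro x hx
      have := hYs hx
      simp only [mem_nn, mem_nb] at this
      tauto
    have hs := crowd hH hR P.sr P.ra P.hν P.big hu.2 hXc.le hYc.le
      (fun x hx => (hXm x hx).2) (fun x hx => (hYm x hx).2)
    have hs' := hs
    rw [nn_sum_comm] at hs'
    have p1 := prune' hs P.νmN
    have p2 := prune' hs' P.νmN
    obtain ⟨Y2, hY2, hY2c⟩ := Finset.exists_subset_card_eq
      (s := Y.filter (fun x => (nn G x X).card ≤ P.m)) (n := P.N) (by omega)
    obtain ⟨X2, hX2, hX2c⟩ := Finset.exists_subset_card_eq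
      (s := X.filter (fun x => (nn G x Y).card ≤ P.m)) (n := P.N) (by omega)
    have hX2' := hX2.trans (Finset.filter_subset _ _)
    have hY2' := hY2.trans (Finset.filter_subset _ _)
    have hT : Tpl G P A (Finset.univ : Finset Bool) (fun b => if b then X2 else Y2) := by
      refine ⟨?_, ?_, ?_, ?_⟩
      · rintro (_ | _) -
        · intro x hx; exact hCA (hYm x (hY2' hx)).1
        · intro x hx; exact hCA (hXm x (hX2' hx)).1
      · rintro (_ | _) -
        · simpa [hY2c] using P.nN
        · simpa [hX2c] using P.nN
      · rintro (_ | _) -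
        · simp [hY2c]
        · simp [hX2c]
      · rintro (_ | _) - (_ | _) - hne x hx
        · exact absurd rfl hne
        · exact (Finset.card_le_card (nn_mono hX2')).trans (Finset.mem_filter.1 (hY2 hx)).2
        · exact (Finset.card_le_card (nn_mono hY2')).trans (Finset.mem_filter.1 (hX2 hx)).2
        · exact absurd rfl hne
    have := hA _ _ _ hT
    simp [hX2c, hY2c] at this
    have := P.hhN
    omega
  · push Not at hu
    obtain ⟨K, hK, hKc, -⟩ := greedy (G := G) (Finset.univ : Finset (Fin P.w))
      (fun _ => nb G v C) (2 * P.N) P.w (by simp)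
      (fun _ _ _ _ _ x hx => (hu x hx).le) (fun _ _ => hcon v hv)
    have := hw K hK
    simp at hKc
    omega

/-- sum estimate for dropping small parts. -/
lemma sum_drop {ι : Type} (I : Finset ι) (f g : ι → ℕ) (n b : ℕ)
    (h : ∀ i ∈ I, f i ≤ g i + b) :
    ∑ i ∈ I, f i ≤ ∑ i ∈ I.filter (fun i => n ≤ g i), g i + I.card * (n + b) := by
  have h1 : ∑ i ∈ I, f i ≤ ∑ i ∈ I, ((if n ≤ g i then g i else 0) + (n + b)) := by
    refine Finset.sum_le_sum (fun i hi => ?_)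
    have := h i hi
    split_ifs <;> omega
  rw [Finset.sum_add_distrib, ← Finset.sum_filter, Finset.sum_const, smul_eq_mul] at h1
  exact h1

/-- merging a template with a near-complete family. -/
lemma merge (hw : CB G P.w) {A : Finset V} {K : ℕ} (hA : CoreLe G P A K)
    {ι κ : Type} {I : Finset ι} {L : ι → Finset V} {J : Finset κ} {T : κ → Finset V}
    (hI : I.card ≤ P.w) (hLA : ∀ i ∈ I, L i ⊆ A) (hLN : ∀ i ∈ I, (L i).card ≤ P.N)
    (hLn : ∀ i ∈ I, ∀ j ∈ I, i ≠ j → ∀ x ∈ L i, (nn G x (L j)).card ≤ P.m)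
    (hT : Tpl G P A J T)
    (hTL : ∀ j ∈ J, ∀ x ∈ T j, ∀ i ∈ I, (nn G x (L i)).card ≤ 2 * P.q) :
    ∑ j ∈ J, (T j).card + ∑ i ∈ I, (L i).card ≤ K + P.EM := by
  have hJ := hT.card_lt hw
  let L2 : ι → Finset V := fun i => (L i).filter (fun x => ∀ j ∈ J, (nn G x (T j)).card ≤ P.m)
  have hL2 : ∀ i, L2 i ⊆ L i := fun i => Finset.filter_subset _ _
  let I2 := I.filter (fun i => P.n ≤ (L2 i).card)
  have hloss : ∀ i ∈ I, (L i).card ≤ (L2 i).card + P.bb := by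
    intro i hi
    have hb : ∀ j ∈ J,
        ((L i).filter (fun x => P.m + 1 ≤ (nn G x (T j)).card)).card * P.m
          ≤ P.N * (2 * P.q) := by
      intro j hj
      refine (Nat.mul_le_mul_left _ (Nat.le_succ _)).trans ((bad_mul_le _ _ _).trans ?_)
      rw [nn_sum_comm]
      calc _ ≤ ∑ x ∈ T j, 2 * P.q := Finset.sum_le_sum (fun x hx => hTL j hj x hx i hi)
        _ = (T j).card * (2 * P.q) := by simp
        _ ≤ _ := Nat.mul_le_mul_right _ (hT.hi j hj)
    have hcov : L i ⊆ L2 i ∪ J.biUnion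
        (fun j => (L i).filter (fun x => P.m + 1 ≤ (nn G x (T j)).card)) := by
      intro x hx
      by_cases h : ∀ j ∈ J, (nn G x (T j)).card ≤ P.m
      · exact Finset.mem_union_left _ (Finset.mem_filter.2 ⟨hx, h⟩)
      · push Not at h
        obtain ⟨j, hj, h⟩ := h
        exact Finset.mem_union_right _ (Finset.mem_biUnion.2 ⟨j, hj, Finset.mem_filter.2 ⟨hx, h⟩⟩)
    have h1 := (Finset.card_le_card hcov).trans (Finset.card_union_le _ _)
    have h2 := Finset.card_biUnion_le (s := J)
      (t := fun j => (L i).filter (fun x => P.m + 1 ≤ (nn G x (T j)).card))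
    have h3 : (∑ j ∈ J, ((L i).filter (fun x => P.m + 1 ≤ (nn G x (T j)).card)).card) * P.m
        ≤ P.m * P.bb := by
      rw [Finset.sum_mul]
      refine (Finset.sum_le_sum hb).trans ?_
      rw [Finset.sum_const, smul_eq_mul]
      exact (Nat.mul_le_mul_right _ hJ.le).trans P.hbb
    have hm : 0 < P.m := P.r1.trans P.rm
    rw [mul_comm] at h3
    have h4 := Nat.le_of_mul_le_mul_left h3 hm
    omega
  have hT' : Tpl G P A (J.disjSum I2) (Sum.elim T L2) := by
    have hI2 : ∀ i ∈ I2, i ∈ I := fun i hi => (Finset.mem_filter.1 hi).1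
    refine ⟨?_, ?_, ?_, ?_⟩
    · intro k hk
      rcases k with j | i
      · exact hT.sub j (by simpa using hk)
      · exact (hL2 i).trans (hLA i (hI2 i (by simpa using hk)))
    · intro k hk
      rcases k with j | i
      · exact hT.lo j (by simpa using hk)
      · exact (Finset.mem_filter.1 (show i ∈ I2 by simpa using hk)).2
    · intro k hk
      rcases k with j | i
      · exact hT.hi j (by simpa using hk)
      · exact (Finset.card_le_card (hL2 i)).trans (hLN i (hI2 i (by simpa using hk)))
    · intro k hk k' hk' hne x hx
      rcases k with j | i <;> rcases k' with j' | i'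
      · exact hT.near j (by simpa using hk) j' (by simpa using hk') (fun h => hne (by rw [h])) x hx
      · refine (Finset.card_le_card (nn_mono (hL2 i'))).trans
          ((hTL j (by simpa using hk) x hx i' (hI2 i' (by simpa using hk'))).trans P.qm)
      · exact (Finset.mem_filter.1 hx).2 j' (by simpa using hk')
      · exact (Finset.card_le_card (nn_mono (hL2 i'))).trans
          (hLn i (hI2 i (by simpa using hk)) i' (hI2 i' (by simpa using hk'))
            (fun h => hne (by rw [h])) x (hL2 i hx))
  have h1 := hA _ _ _ hT'
  rw [Finset.sum_disjSum] at h1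
  simp only [Sum.elim_inl, Sum.elim_inr] at h1
  have h2 := sum_drop I (fun i => (L i).card) (fun i => (L2 i).card) P.n P.bb hloss
  have h3 : I.card * (P.n + P.bb) ≤ P.EM := by
    have := P.hEM
    rw [← mul_add] at this
    exact (Nat.mul_le_mul_right _ hI).trans this
  change _ ≤ ∑ i ∈ I2, (L2 i).card + _ at h2
  omega

end DS

namespace DS
open Classical
variable {V : Type} {G : SimpleGraph V} {P : Par}

/-- clique number of a subset. -/
noncomputable def cw (G : SimpleGraph V) (X : Finset V) : ℕ :=
  (X.powerset.filter (fun K : Finset V => G.IsClique (K : Set V))).sup Finset.card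

lemma le_cw {X K : Finset V} (hK : K ⊆ X) (hc : G.IsClique (K : Set V)) : K.card ≤ cw G X :=
  Finset.le_sup (f := Finset.card) (Finset.mem_filter.2 ⟨Finset.mem_powerset.2 hK, hc⟩)

lemma cw_le {X : Finset V} {o : ℕ}
    (h : ∀ K ⊆ X, G.IsClique (K : Set V) → K.card ≤ o) : cw G X ≤ o := by
  refine Finset.sup_le (fun K hK => ?_)
  rw [Finset.mem_filter, Finset.mem_powerset] at hK
  exact h K hK.1 hK.2

lemma cw_mono {X Y : Finset V} (h : X ⊆ Y) : cw G X ≤ cw G Y :=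
  cw_le (fun _ hK hc => le_cw (hK.trans h) hc)

lemma cw_lt (hw : CB G P.w) (X : Finset V) : cw G X < P.w := by
  have : cw G X ≤ P.w - 1 := cw_le (fun K _ hc => by have := hw K hc; omega)
  have := P.w2
  omega

lemma exists_cw (X : Finset V) : ∃ K ⊆ X, G.IsClique (K : Set V) ∧ K.card = cw G X := by
  have : (X.powerset.filter (fun K : Finset V => G.IsClique (K : Set V))).Nonempty :=
    ⟨∅, by simp⟩
  obtain ⟨K, hK, h⟩ := Finset.exists_mem_eq_sup _ this Finset.card
  rw [Finset.mem_filter, Finset.mem_powerset] at hK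
  exact ⟨K, hK.1, hK.2, h.symm⟩

/-- a vertex complete to `X` raises the clique number. -/
lemma cw_succ {X Y : Finset V} {x : V} (hXY : X ⊆ Y) (hx : x ∈ Y) (h : ∀ y ∈ X, G.Adj x y) :
    cw G X + 1 ≤ cw G Y := by
  obtain ⟨K, hK, hKc, hc⟩ := exists_cw (G := G) X
  obtain ⟨h1, h2⟩ := clique_insert hKc (x := x) (fun k hk => (h k (hK hk)).symm)
  have := le_cw (Finset.insert_subset hx (hK.trans hXY)) h1
  omega

/-- value of a template. -/
noncomputable def Phi (G : SimpleGraph V) (P : Par) {ι : Type} (I : Finset ι)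
    (L : ι → Finset V) : ℕ :=
  ∑ i ∈ I, (L i).card + P.n0 * I.card + P.l * (P.w - cw G (I.biUnion L))

/-- optimal templates. -/
structure Opt (G : SimpleGraph V) (P : Par) (A : Finset V) {ι : Type} (I : Finset ι)
    (L : ι → Finset V) : Prop extends Tpl G P A I L where
  opt : ∀ (κ : Type) (J : Finset κ) (T : κ → Finset V), Tpl G P A J T →
    Phi G P J T ≤ Phi G P I L

lemma exists_opt (hw : CB G P.w) (A : Finset V) :
    ∃ (ι : Type) (I : Finset ι) (L : ι → Finset V), Opt G P A I L := by
  let S : Set ℕ := {v | ∃ (ι : Type) (I : Finset ι) (L : ι → Finset V),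
    Tpl G P A I L ∧ Phi G P I L = v}
  have hne : S.Nonempty := ⟨_, Empty, ∅, fun _ => ∅, ⟨by simp, by simp, by simp, by simp⟩, rfl⟩
  have hb : BddAbove S := by
    refine ⟨P.w * P.N + P.n0 * P.w + P.l * P.w, ?_⟩
    rintro v ⟨ι, I, L, hT, rfl⟩
    have h1 := hT.card_lt hw
    unfold Phi
    have h2 : ∑ i ∈ I, (L i).card ≤ I.card * P.N := by
      simpa using Finset.sum_le_sum (g := fun _ => P.N) hT.hi
    have h3 := Nat.mul_le_mul_right P.N h1.le
    have h4 := Nat.mul_le_mul_left P.n0 h1.le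
    have h5 := Nat.mul_le_mul_left P.l (Nat.sub_le P.w (cw G (I.biUnion L)))
    omega
  obtain ⟨ι, I, L, hT, hv⟩ := Nat.sSup_mem hne hb
  refine ⟨ι, I, L, hT, ?_⟩
  intro κ J T hT'
  rw [hv]
  exact le_csSup hb ⟨κ, J, T, hT', rfl⟩

lemma Opt.core (hw : CB G P.w) {A : Finset V} {ι : Type} {I : Finset ι} {L : ι → Finset V}
    (hO : Opt G P A I L) :
    CoreLe G P A (∑ i ∈ I, (L i).card + (P.w * P.n0 + P.w * P.l)) := by
  intro κ J T hT
  have h1 := hO.opt κ J T hT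
  unfold Phi at h1
  have h2 := Nat.mul_le_mul_left P.n0 (hO.toTpl.card_lt hw).le
  have h3 := Nat.mul_le_mul_left P.l (Nat.sub_le P.w (cw G (I.biUnion L)))
  rw [mul_comm P.w, mul_comm P.w]
  omega

/-- every vertex has many non-neighbours in its own part. -/
lemma Opt.star (hw : CB G P.w) {A : Finset V} {ι : Type} {I : Finset ι} {L : ι → Finset V}
    (hO : Opt G P A I L) {i : ι} (hi : i ∈ I) {x : V} (hx : x ∈ L i) :
    P.l1 ≤ (nn G x (L i)).card := by
  by_contra hcon
  push Not at hcon
  have hI := hO.toTpl.card_lt hw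
  let I2 := I.filter (fun j => P.n ≤ (nb G x (L j)).card)
  have hI2 : I2 ⊆ I := Finset.filter_subset _ _
  have hT : Tpl G P A I2 (fun j => nb G x (L j)) := by
    refine ⟨?_, ?_, ?_, ?_⟩
    · intro j hj; exact nb_sub.trans (hO.sub j (hI2 hj))
    · intro j hj; exact (Finset.mem_filter.1 hj).2
    · intro j hj; exact (Finset.card_le_card nb_sub).trans (hO.hi j (hI2 hj))
    · intro j hj k hk hne y hy
      exact (Finset.card_le_card (nn_mono nb_sub)).trans
        (hO.near j (hI2 hj) k (hI2 hk) hne y (nb_sub hy))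
  have h1 := hO.opt _ _ _ hT
  have hcw : cw G (I2.biUnion (fun j => nb G x (L j))) + 1 ≤ cw G (I.biUnion L) := by
    apply cw_succ (x := x)
    · intro y hy
      obtain ⟨j, hj, hy⟩ := Finset.mem_biUnion.1 hy
      exact Finset.mem_biUnion.2 ⟨j, hI2 hj, nb_sub hy⟩
    · exact Finset.mem_biUnion.2 ⟨i, hi, hx⟩
    · intro y hy
      obtain ⟨j, hj, hy⟩ := Finset.mem_biUnion.1 hy
      exact (mem_nb.1 hy).2
  have hcw2 := cw_lt hw (I.biUnion L)
  unfold Phi at h1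
  have h2 : P.l * (P.w - cw G (I.biUnion L)) + P.l
      ≤ P.l * (P.w - cw G (I2.biUnion (fun j => nb G x (L j)))) := by
    rw [← Nat.mul_succ]
    exact Nat.mul_le_mul_left _ (by omega)
  have h3 := Nat.mul_le_mul_left P.n0 hI.le
  -- core comparison
  have h4 : ∑ j ∈ I, (L j).card ≤ ∑ j ∈ I, ((nb G x (L j)).card + P.m)  + P.l1 := by
    rw [← Finset.add_sum_erase I _ hi, ← Finset.add_sum_erase I _ hi]
    have e1 := nb_add_nn (G := G) x (L i)
    have e2 : ∑ j ∈ I.erase i, (L j).card ≤ ∑ j ∈ I.erase i, ((nb G x (L j)).card + P.m) := by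
      refine Finset.sum_le_sum (fun j hj => ?_)
      have := nb_add_nn (G := G) x (L j)
      have := hO.near i hi j (Finset.mem_of_mem_erase hj) (Finset.ne_of_mem_erase hj).symm x hx
      omega
    omega
  have h5 := sum_drop I (fun j => (nb G x (L j)).card + P.m) (fun j => (nb G x (L j)).card)
    P.n P.m (fun _ _ => le_rfl)
  have h6 := Nat.mul_le_mul_right (P.n + P.m) hI.le
  have h6' : P.w * (P.n + P.m) = P.w * P.n + P.w * P.m := mul_add _ _ _
  have h7 := P.hl
  simp only at h1
  change _ ≤ ∑ i ∈ I2, (nb G x (L i)).card + _ at h5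
  have h8 : P.n0 * P.w = P.w * P.n0 := mul_comm _ _
  omega

/-- few non-edges between distinct parts. -/
lemma Opt.nonedges (hH : HF G P.s) (hR : Ram G P.s P.r) (hw : CB G P.w)
    {A : Finset V} {ι : Type} {I : Finset ι} {L : ι → Finset V}
    (hO : Opt G P A I L) {i j : ι} (hi : i ∈ I) (hj : j ∈ I) (hij : i ≠ j) :
    (∑ b ∈ L i, (nn G b (L j)).card) * ((P.l1 - 2 * P.m) * (P.l1 - 2 * P.m))
      ≤ P.N * P.N * P.ν := by
  let S := (L i ×ˢ L j).filter (fun p => ¬ G.Adj p.1 p.2)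
  let R : V × V → V × V → Prop := fun p z =>
    G.Adj z.1 z.2 ∧ (G.Adj z.2 p.1 ∧ ¬ G.Adj z.1 p.1) ∧ (G.Adj z.1 p.2 ∧ ¬ G.Adj z.2 p.2)
  have hfil : ∀ X Y : Finset V, ((X ×ˢ Y).filter (fun p => ¬ G.Adj p.1 p.2)).card
      = ∑ b ∈ X, (nn G b Y).card := by
    intro X Y
    rw [Finset.card_filter, Finset.sum_product]
    refine Finset.sum_congr rfl (fun b _ => ?_)
    unfold nn
    rw [Finset.card_filter]
  have hS : S.card = ∑ b ∈ L i, (nn G b (L j)).card := hfil _ _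
  rw [← hS]
  have key := Finset.card_mul_le_card_mul (s := S) (t := L i ×ˢ L j) R
    (m := (P.l1 - 2 * P.m) * (P.l1 - 2 * P.m)) (n := P.ν) ?_ ?_
  · refine key.trans (Nat.mul_le_mul_right _ ?_)
    rw [Finset.card_product]
    exact Nat.mul_le_mul (hO.hi i hi) (hO.hi j hj)
  · rintro ⟨b, d⟩ hp
    obtain ⟨hp1, hbd⟩ := Finset.mem_filter.1 hp
    obtain ⟨hb, hd⟩ := Finset.mem_product.1 hp1
    simp only at hb hd hbd
    let X1 := nb G d (nn G b (L i))
    let F : V → Finset V := fun x => nb G x (nb G b (nn G d (L j)))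
    have hX1 : P.l1 - 2 * P.m ≤ X1.card := by
      have e1 := hO.star hw hi hb
      have e2 := nb_add_nn (G := G) d (nn G b (L i))
      have e3 := hO.near j hj i hi hij.symm d hd
      have e4 := Finset.card_le_card (nn_mono (G := G) (v := d) (nn_sub (G := G) (v := b) (X := L i)))
      change _ ≤ (nb G d (nn G b (L i))).card
      omega
    have hF : ∀ x ∈ X1, P.l1 - 2 * P.m ≤ (F x).card := by
      intro x hx
      have hxi : x ∈ L i := nn_sub (nb_sub hx)
      have e1 := hO.star hw hj hd
      have e2 := nb_add_nn (G := G) b (nn G d (L j))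
      have e3 := nb_add_nn (G := G) x (nb G b (nn G d (L j)))
      have e4 := hO.near i hi j hj hij b hb
      have e5 := hO.near i hi j hj hij x hxi
      have e6 := Finset.card_le_card (nn_mono (G := G) (v := b) (nn_sub (G := G) (v := d) (X := L j)))
      have e7 := Finset.card_le_card (nn_mono (G := G) (v := x)
        ((nb_sub (G := G) (v := b)).trans (nn_sub (G := G) (v := d) (X := L j))))
      change _ ≤ (nb G x (nb G b (nn G d (L j)))).card
      omega
    have hsub : (X1.sigma F).image (fun p => ((p.1, p.2) : V × V)) ⊆
        Finset.bipartiteAbove R (L i ×ˢ L j) (b, d) := by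
      intro z hz
      obtain ⟨⟨x, y⟩, hxy, rfl⟩ := Finset.mem_image.1 hz
      obtain ⟨hx, hy⟩ := Finset.mem_sigma.1 hxy
      simp only [X1, F, mem_nb, mem_nn] at hx hy
      simp only [Finset.bipartiteAbove, Finset.mem_filter, Finset.mem_product, R]
      refine ⟨⟨hx.1.1, hy.1.1.1⟩, hy.2, ⟨hy.1.2.symm, fun h => hx.1.2 h.symm⟩,
        hx.2.symm, fun h => hy.1.1.2 h.symm⟩
    refine le_trans ?_ (Finset.card_le_card hsub)
    rw [Finset.card_image_of_injective _ (by
      rintro ⟨x, y⟩ ⟨x', y'⟩ h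
      simp only [Prod.mk.injEq] at h
      obtain ⟨rfl, rfl⟩ := h
      rfl), Finset.card_sigma]
    calc _ ≤ X1.card * (P.l1 - 2 * P.m) := Nat.mul_le_mul_right _ hX1
      _ = ∑ x ∈ X1, (P.l1 - 2 * P.m) := by simp
      _ ≤ _ := Finset.sum_le_sum hF
  · rintro ⟨x, y⟩ hz
    obtain ⟨hx, hy⟩ := Finset.mem_product.1 hz
    simp only at hx hy
    by_cases hxy : G.Adj x y
    · let X := (L i).filter (fun b => G.Adj y b ∧ ¬ G.Adj x b)
      let Y := (L j).filter (fun d => G.Adj x d ∧ ¬ G.Adj y d)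
      have hN : ∀ k ∈ I, ∀ Z ⊆ L k, Z.card ≤ 2 * P.N := by
        intro k hk Z hZ
        have := Finset.card_le_card hZ
        have := hO.hi k hk
        omega
      have hs := crowd hH hR P.sr P.ra P.hν P.big hxy.symm
        (hN i hi X (Finset.filter_subset _ _)) (hN j hj Y (Finset.filter_subset _ _))
        (fun b hb => (Finset.mem_filter.1 hb).2) (fun b hb => (Finset.mem_filter.1 hb).2)
      rw [nn_sum_comm, ← hfil] at hs
      refine (Finset.card_le_card ?_).trans hs
      rintro ⟨b, d⟩ hp
      simp only [Finset.bipartiteBelow, Finset.mem_filter, S, R, Finset.mem_product] at hp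
      simp only [Finset.mem_filter, X, Y, Finset.mem_product]
      tauto
    · have : Finset.bipartiteBelow R S (x, y) = ∅ := by
        rw [Finset.eq_empty_iff_forall_notMem]
        intro p hp
        simp only [Finset.bipartiteBelow, Finset.mem_filter, R] at hp
        exact hxy hp.2.1
      rw [this]; simp

/-- the package extracted from an optimal template. -/
structure Pack (G : SimpleGraph V) (P : Par) (A : Finset V) {ι : Type} (I : Finset ι)
    (L : ι → Finset V) : Prop where
  sub : ∀ i ∈ I, L i ⊆ A
  card : I.card < P.w
  hi : ∀ i ∈ I, (L i).card ≤ P.N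
  lo : ∀ i ∈ I, P.l1 ≤ (L i).card + P.q0
  near : ∀ i ∈ I, ∀ j ∈ I, i ≠ j → ∀ x ∈ L i, (nn G x (L j)).card < P.q0
  core : CoreLe G P A (∑ i ∈ I, (L i).card + P.E1)
  split : ∀ i ∈ I, ∀ X ⊆ L i, ∀ Y ⊆ L i, X.Nonempty → (L i \ (X ∪ Y)).card ≤ P.q0 →
    (∀ p ∈ X, (nn G p Y).card < P.r) → Y.card < P.q0

lemma Opt.split_aux (hw : CB G P.w) {A : Finset V} {ι : Type} {I : Finset ι}
    {L : ι → Finset V} (hO : Opt G P A I L) {i : ι} (hi : i ∈ I) {X Y : Finset V}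
    (hX : X ⊆ L i) (hY : Y ⊆ L i) (hXne : X.Nonempty)
    (hcov : (L i \ (X ∪ Y)).card ≤ 2 * P.q0)
    (hXY : ∀ p ∈ X, (nn G p Y).card < P.r) : Y.card < P.q0 := by
  by_contra hcon
  push Not at hcon
  obtain ⟨p, hp⟩ := hXne
  have hsplit : ∀ z, (nn G z (L i)).card ≤ (nn G z X).card + (nn G z Y).card + 2 * P.q0 := by
    intro z
    have : nn G z (L i) ⊆ (nn G z X ∪ nn G z Y) ∪ (L i \ (X ∪ Y)) := by
      intro y hy
      have := mem_nn.1 hy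
      simp only [Finset.mem_union, mem_nn, Finset.mem_sdiff]
      tauto
    have h1 := (Finset.card_le_card this).trans (Finset.card_union_le _ _)
    have h2 := Finset.card_union_le (nn G z X) (nn G z Y)
    omega
  have hnl := P.hnl
  have hXn : P.n ≤ X.card := by
    have h1 := hO.star hw hi (hX hp)
    have h2 := hsplit p
    have h3 := hXY p hp
    have h4 := Finset.card_le_card (nn_sub (G := G) (v := p) (X := X))
    omega
  have hsum : ∑ y ∈ Y, (nn G y X).card ≤ P.N * P.r := by
    rw [nn_sum_comm]
    calc _ ≤ ∑ x ∈ X, P.r := Finset.sum_le_sum (fun x hx => (hXY x hx).le)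
      _ = X.card * P.r := by simp
      _ ≤ _ := Nat.mul_le_mul_right _ ((Finset.card_le_card hX).trans (hO.hi i hi))
  have hx : ∃ x ∈ Y, (nn G x X).card ≤ P.t := by
    by_contra h
    push Not at h
    have h1 : Y.card * (P.t + 1) ≤ ∑ y ∈ Y, (nn G y X).card := by
      rw [← smul_eq_mul, ← Finset.sum_const]
      exact Finset.sum_le_sum h
    have h2 := Nat.mul_le_mul_right (P.t + 1) hcon
    have := P.ht
    omega
  obtain ⟨x, hxY, hxt⟩ := hx
  let Y2 := Y.filter (fun y => (nn G y X).card ≤ P.m)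
  have hY2 : Y2 ⊆ Y := Finset.filter_subset _ _
  have hY2c : Y.card < Y2.card + (P.t + 1) := by
    refine prune' hsum (P.ht.trans_le (Nat.mul_le_mul_right _ ?_))
    have := P.hq0m
    omega
  have hYl : P.l1 ≤ Y.card + 2 * P.q0 + P.t := by
    have h1 := hO.star hw hi (hY hxY)
    have h2 := hsplit x
    have h4 := Finset.card_le_card (nn_sub (G := G) (v := x) (X := Y))
    omega
  let T : Option ι → Finset V := fun k => k.elim Y2 (fun j => if j = i then X else L j)
  have hTi : T (some i) = X := by simp [T]
  have hTj : ∀ j, j ≠ i → T (some j) = L j := fun j hj => by simp [T, hj]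
  have hTn : T none = Y2 := rfl
  have hTs : ∀ j, T (some j) ⊆ L j := by
    intro j
    by_cases h : j = i
    · subst h; rw [hTi]; exact hX
    · rw [hTj j h]
  have hT : Tpl G P A (Finset.insertNone I) T := by
    refine ⟨?_, ?_, ?_, ?_⟩
    · intro k hk
      rcases k with _ | j
      · exact (hY2.trans hY).trans (hO.sub i hi)
      · exact (hTs j).trans (hO.sub j (by simpa using hk))
    · intro k hk
      rcases k with _ | j
      · rw [hTn]; omega
      · by_cases h : j = i
        · subst h; rw [hTi]; exact hXn
        · rw [hTj j h]; exact hO.lo j (by simpa using hk)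
    · intro k hk
      rcases k with _ | j
      · exact (Finset.card_le_card (hY2.trans hY)).trans (hO.hi i hi)
      · exact (Finset.card_le_card (hTs j)).trans (hO.hi j (by simpa using hk))
    · intro k hk k' hk' hne z hz
      rcases k with _ | j <;> rcases k' with _ | j'
      · exact absurd rfl hne
      · by_cases h : j' = i
        · subst h; rw [hTi]; exact (Finset.mem_filter.1 hz).2
        · rw [hTj j' h]
          exact hO.near i hi j' (by simpa using hk') (fun e => h e.symm) z (hY (hY2 hz))
      · by_cases h : j = i
        · subst h; rw [hTi] at hz; rw [hTn]
          exact (Finset.card_le_card (nn_mono hY2)).trans ((hXY z hz).le.trans P.rm)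
        · rw [hTj j h] at hz
          exact (Finset.card_le_card (nn_mono (hY2.trans hY))).trans
            (hO.near j (by simpa using hk) i hi h z hz)
      · exact (Finset.card_le_card (nn_mono (hTs j'))).trans
          (hO.near j (by simpa using hk) j' (by simpa using hk') (fun e => hne (by rw [e])) z
            (hTs j hz))
  have h1 := hO.opt _ _ _ hT
  have hcw : cw G ((Finset.insertNone I).biUnion T) ≤ cw G (I.biUnion L) := by
    apply cw_mono
    intro y hy
    obtain ⟨k, hk, hy⟩ := Finset.mem_biUnion.1 hy
    rcases k with _ | j
    · exact Finset.mem_biUnion.2 ⟨i, hi, hY (hY2 hy)⟩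
    · exact Finset.mem_biUnion.2 ⟨j, by simpa using hk, hTs j hy⟩
  unfold Phi at h1
  have h2 := Nat.mul_le_mul_left P.l (Nat.sub_le_sub_left hcw P.w)
  rw [Finset.card_insertNone, Finset.sum_insertNone, hTn] at h1
  have h3 : ∑ j ∈ I, (L j).card + X.card = ∑ j ∈ I, (T (some j)).card + (L i).card := by
    rw [← Finset.add_sum_erase I _ hi, ← Finset.add_sum_erase I (fun j => (T (some j)).card) hi]
    have : ∑ j ∈ I.erase i, (L j).card = ∑ j ∈ I.erase i, (T (some j)).card :=
      Finset.sum_congr rfl (fun j hj => by rw [hTj j (Finset.ne_of_mem_erase hj)])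
    rw [this, hTi]
    ring
  have h4 : (L i).card ≤ X.card + Y.card + 2 * P.q0 := by
    have e1 := Finset.card_sdiff_add_card_eq_card (Finset.union_subset hX hY)
    have e2 := Finset.card_union_le X Y
    omega
  have h5 := P.hn0
  rw [mul_add] at h1
  omega

lemma exists_pack (hH : HF G P.s) (hR : Ram G P.s P.r) (hw : CB G P.w) (A : Finset V) :
    ∃ (ι : Type) (I : Finset ι) (L : ι → Finset V), Pack G P A I L := by
  obtain ⟨ι, I, L, hO⟩ := exists_opt hw A
  have hI := hO.toTpl.card_lt hw
  let L2 : ι → Finset V := fun i =>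
    (L i).filter (fun x => ∀ j ∈ I, i ≠ j → (nn G x (L j)).card < P.q0)
  have hL2 : ∀ i, L2 i ⊆ L i := fun i => Finset.filter_subset _ _
  have hloss : ∀ i ∈ I, (L i \ L2 i).card ≤ P.q0 := by
    intro i hi
    let bad : ι → Finset V := fun j => (L i).filter (fun x => P.q0 ≤ (nn G x (L j)).card)
    have hb : ∀ j ∈ I.erase i, P.w * (bad j).card < P.q0 := by
      intro j hj
      have hji := Finset.ne_of_mem_erase hj
      have hjI := Finset.mem_of_mem_erase hj
      have h1 := hO.nonedges hH hR hw hi hjI hji.symm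
      have h2 := bad_mul_le (G := G) (L i) (L j) P.q0
      by_contra hcon
      push Not at hcon
      have h3 := P.hC
      set Q := (P.l1 - 2 * P.m) * (P.l1 - 2 * P.m)
      have h4 : P.q0 * P.q0 * Q ≤ P.w * (P.N * P.N * P.ν) := by
        calc P.q0 * P.q0 * Q ≤ (P.w * (bad j).card) * P.q0 * Q := by gcongr
          _ = P.w * ((bad j).card * P.q0 * Q) := by ring
          _ ≤ P.w * ((∑ b ∈ L i, (nn G b (L j)).card) * Q) := by gcongr
          _ ≤ _ := by gcongr
      omega
    have hsub : L i \ L2 i ⊆ (I.erase i).biUnion bad := by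
      intro x hx
      rw [Finset.mem_sdiff] at hx
      by_contra hcon
      apply hx.2
      refine Finset.mem_filter.2 ⟨hx.1, fun j hj hij => ?_⟩
      by_contra h
      exact hcon (Finset.mem_biUnion.2 ⟨j, Finset.mem_erase.2 ⟨hij.symm, hj⟩,
        Finset.mem_filter.2 ⟨hx.1, not_lt.1 h⟩⟩)
    have h1 := (Finset.card_le_card hsub).trans Finset.card_biUnion_le
    have h2 : P.w * ∑ j ∈ I.erase i, (bad j).card ≤ P.w * P.q0 := by
      rw [Finset.mul_sum]
      calc _ ≤ ∑ j ∈ I.erase i, P.q0 := Finset.sum_le_sum (fun j hj => (hb j hj).le)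
        _ = (I.erase i).card * P.q0 := by simp
        _ ≤ _ := Nat.mul_le_mul_right _ ((Finset.card_le_card (Finset.erase_subset _ _)).trans hI.le)
    have h3 := Nat.le_of_mul_le_mul_left h2 (by have := P.w2; omega)
    exact h1.trans h3
  have hlc : ∀ i ∈ I, (L i).card ≤ (L2 i).card + P.q0 := by
    intro i hi
    have e1 := Finset.card_sdiff_add_card_eq_card (hL2 i)
    have := hloss i hi
    omega
  have hempty : ∀ i ∈ I, P.l1 ≤ (L i).card := by
    intro i hi
    have hne : (L i).Nonempty := by
      rw [← Finset.card_pos]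
      have := hO.lo i hi
      have := P.wmn
      omega
    obtain ⟨x, hx⟩ := hne
    exact (hO.star hw hi hx).trans (Finset.card_le_card nn_sub)
  refine ⟨ι, I, L2, ?_, hI, ?_, ?_, ?_, ?_, ?_⟩
  · intro i hi; exact (hL2 i).trans (hO.sub i hi)
  · intro i hi; exact (Finset.card_le_card (hL2 i)).trans (hO.hi i hi)
  · intro i hi
    exact (hempty i hi).trans (hlc i hi)
  · intro i hi j hj hij x hx
    exact lt_of_le_of_lt (Finset.card_le_card (nn_mono (hL2 j))) ((Finset.mem_filter.1 hx).2 j hj hij)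
  · intro κ J T hT
    have h1 := hO.core hw κ J T hT
    have h2 : ∑ i ∈ I, (L i).card ≤ ∑ i ∈ I, (L2 i).card + I.card * P.q0 := by
      have := Finset.sum_le_sum hlc
      rwa [Finset.sum_add_distrib, Finset.sum_const, smul_eq_mul] at this
    have h3 := Nat.mul_le_mul_right P.q0 hI.le
    have h4 := P.hE1
    omega
  · intro i hi X hX Y hY hne hcov hXY
    refine hO.split_aux hw hi (hX.trans (hL2 i)) (hY.trans (hL2 i)) hne ?_ hXY
    have : L i \ (X ∪ Y) ⊆ (L2 i \ (X ∪ Y)) ∪ (L i \ L2 i) := by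
      intro x hx
      simp only [Finset.mem_union, Finset.mem_sdiff] at hx ⊢
      tauto
    have h1 := (Finset.card_le_card this).trans (Finset.card_union_le _ _)
    have := hloss i hi
    omega

/-- the package is a template. -/
lemma Pack.tpl {A : Finset V} {ι : Type} {I : Finset ι} {L : ι → Finset V}
    (hP : Pack G P A I L) : Tpl G P A I L := by
  refine ⟨hP.sub, ?_, hP.hi, ?_⟩
  · intro i hi
    have := hP.lo i hi
    have := P.hnl
    omega
  · intro i hi j hj hij x hx
    exact (hP.near i hi j hj hij x hx).le.trans P.hq0m

end DS

namespace DS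
open Classical
variable {V : Type} {G : SimpleGraph V} {P : Par}

/-- pendant vertices with respect to `U`. -/
def Pend (G : SimpleGraph V) (s : ℕ) (U : Finset V) (v : V) : Prop :=
  ∃ u ∈ U, ∃ p ∈ U, ∃ S ⊆ U, S.card = s ∧ Stab G S ∧ G.Adj u p ∧
    (∀ a ∈ S, G.Adj u a ∧ ¬ G.Adj p a) ∧ G.Adj p v ∧ ¬ G.Adj u v ∧ ∀ a ∈ S, ¬ G.Adj a v

lemma pend_bound {s r : ℕ} (hH : HF G s) (hR : Ram G s r) (A U : Finset V) :
    (A.filter (Pend G s U)).card ≤ U.card * U.card * U.card ^ s * r := by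
  let Idx := (U ×ˢ U) ×ˢ (U.powersetCard s)
  let Ok : (V × V) × Finset V → V → Prop := fun z v =>
    Stab G z.2 ∧ G.Adj z.1.1 z.1.2 ∧
    (∀ a ∈ z.2, G.Adj z.1.1 a ∧ ¬ G.Adj z.1.2 a) ∧ G.Adj z.1.2 v ∧ ¬ G.Adj z.1.1 v ∧
      ∀ a ∈ z.2, ¬ G.Adj a v
  have hsub : A.filter (Pend G s U) ⊆ Idx.biUnion (fun z => A.filter (Ok z)) := by
    intro v hv
    obtain ⟨hvA, u, hu, p, hp, S, hS, hSc, h⟩ := Finset.mem_filter.1 hv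
    refine Finset.mem_biUnion.2 ⟨((u, p), S), ?_, Finset.mem_filter.2 ⟨hvA, h⟩⟩
    simp only [Idx, Finset.mem_product, Finset.mem_powersetCard]
    exact ⟨⟨hu, hp⟩, hS, hSc⟩
  have hI : Idx.card ≤ U.card * U.card * U.card ^ s := by
    simp only [Idx, Finset.card_product, Finset.card_powersetCard]
    exact Nat.mul_le_mul_left _ (Nat.choose_le_pow _ _)
  refine (Finset.card_le_card hsub).trans ((Finset.card_biUnion_le_card_mul _ _ r ?_).trans
    (Nat.mul_le_mul_right _ hI))
  rintro ⟨⟨u, p⟩, S⟩ hz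
  simp only [Idx, Finset.mem_product, Finset.mem_powersetCard] at hz
  by_contra hcon
  push Not at hcon
  obtain ⟨T, hT, hTc, hTs⟩ := hR _ hcon.le
  have hT' : ∀ v ∈ T, Ok ((u, p), S) v := fun v hv => (Finset.mem_filter.1 (hT hv)).2
  have hne : (A.filter (Ok ((u, p), S))).Nonempty := by
    rw [← Finset.card_pos]; omega
  obtain ⟨v0, hv0⟩ := hne
  obtain ⟨h1, h2, h3, -⟩ := (Finset.mem_filter.1 hv0).2
  simp only at h1 h2 h3
  refine hH u p h2 S T hz.2.2 hTc h1 hTs h3 ?_ ?_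
  · intro b hb
    obtain ⟨-, -, -, h4, h5, -⟩ := hT' b hb
    exact ⟨h4, h5⟩
  · intro a ha b hb
    obtain ⟨-, -, -, -, -, h6⟩ := hT' b hb
    exact h6 a ha

section pack
variable {A : Finset V} {ι : Type} {I : Finset ι} {L : ι → Finset V}

lemma Pack.nonpend (hR : Ram G P.s P.r) (hP : Pack G P A I L) {v : V}
    (hv : ¬ Pend G P.s (I.biUnion L) v) {i j : ι} (hi : i ∈ I) (hj : j ∈ I) (hij : i ≠ j)
    {u p : V} (hu : u ∈ L j) (hvu : ¬ G.Adj v u) (hp : p ∈ L i) (hvp : G.Adj v p)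
    (hup : G.Adj u p) : (nn G v (L i)).card < 2 * P.q0 := by
  have hU : ∀ k ∈ I, ∀ x ∈ L k, x ∈ I.biUnion L := fun k hk x hx =>
    Finset.mem_biUnion.2 ⟨k, hk, hx⟩
  have hn := hP.near j hj i hi hij.symm u hu
  have h1 := hP.split i hi (nb G u (nb G v (L i))) (nb_sub.trans nb_sub)
    (nb G u (nn G v (L i))) (nb_sub.trans nn_sub)
    ⟨p, mem_nb.2 ⟨mem_nb.2 ⟨hp, hvp⟩, hup⟩⟩ ?_ ?_
  · have h2 := nb_add_nn (G := G) u (nn G v (L i))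
    have h3 := Finset.card_le_card (nn_mono (G := G) (v := u) (nn_sub (G := G) (v := v) (X := L i)))
    omega
  · refine (Finset.card_le_card (t := nn G u (L i)) ?_).trans hn.le
    intro x hx
    simp only [Finset.mem_sdiff, Finset.mem_union, mem_nb, mem_nn] at hx ⊢
    tauto
  · intro p' hp'
    by_contra hcon
    push Not at hcon
    obtain ⟨S, hS, hSc, hSs⟩ := hR _ hcon
    apply hv
    have hS' : ∀ a ∈ S, a ∈ L i ∧ ¬ G.Adj v a ∧ G.Adj u a ∧ ¬ G.Adj p' a := by
      intro a ha
      have := hS ha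
      simp only [mem_nb, mem_nn] at this
      tauto
    simp only [mem_nb] at hp'
    refine ⟨u, hU j hj u hu, p', hU i hi p' hp'.1.1, S, fun a ha => hU i hi a (hS' a ha).1, hSc,
      hSs, hp'.2, fun a ha => (hS' a ha).2.2, hp'.1.2.symm, fun h => hvu h.symm,
      fun a ha h => (hS' a ha).2.1 h.symm⟩

/-- parts where `v` has many non-neighbours. -/
noncomputable def Jv (G : SimpleGraph V) (P : Par) (I : Finset ι) (L : ι → Finset V) (v : V) :
    Finset ι := I.filter (fun i => P.q ≤ (nn G v (L i)).card)

lemma Jv_sub (v : V) : Jv G P I L v ⊆ I := Finset.filter_subset _ _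

lemma mem_Jv {v : V} {i : ι} : i ∈ Jv G P I L v ↔ i ∈ I ∧ P.q ≤ (nn G v (L i)).card := by
  simp [Jv]

lemma Pack.pure (hR : Ram G P.s P.r) (hP : Pack G P A I L) {v : V}
    (hv : ¬ Pend G P.s (I.biUnion L) v) {i j : ι} (hi : i ∈ Jv G P I L v)
    (hj : j ∈ Jv G P I L v) (hij : i ≠ j) : ∀ p ∈ L i, ¬ G.Adj v p := by
  intro p hp hvp
  rw [mem_Jv] at hi hj
  have hn := hP.near i hi.1 j hj.1 hij p hp
  have h2 := nb_add_nn (G := G) p (nn G v (L j))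
  have h3 := Finset.card_le_card (nn_mono (G := G) (v := p) (nn_sub (G := G) (v := v) (X := L j)))
  have h4 := P.rq0
  have h5 := P.r1
  have : (nb G p (nn G v (L j))).Nonempty := by
    rw [← Finset.card_pos]; omega
  obtain ⟨u, hu⟩ := this
  simp only [mem_nb, mem_nn] at hu
  have := hP.nonpend hR hv hi.1 hj.1 hij hu.1.1 hu.1.2 hp hvp hu.2.symm
  omega

lemma Pack.pure2 (hR : Ram G P.s P.r) (hP : Pack G P A I L) {v : V}
    (hv : ¬ Pend G P.s (I.biUnion L) v) (h2 : 2 ≤ (Jv G P I L v).card) {i : ι}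
    (hi : i ∈ Jv G P I L v) : ∀ p ∈ L i, ¬ G.Adj v p := by
  obtain ⟨j, hj, hne⟩ := Finset.exists_mem_ne (by omega : 1 < (Jv G P I L v).card) i
  exact hP.pure hR hv hi hj hne.symm

lemma Pack.coreJ (hw : CB G P.w) (hP : Pack G P A I L) (J : Finset ι) (hJ : J ⊆ I)
    {M : Finset V} (hM : M ⊆ A) (hMJ : ∀ v ∈ M, Jv G P I L v = J) :
    CoreLe G P M (∑ j ∈ J, (L j).card + (P.E1 + P.EM)) := by
  intro κ K T hT
  have hI : ∀ i ∈ I \ J, i ∈ I := fun i hi => (Finset.mem_sdiff.1 hi).1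
  have h1 := merge hw hP.core (I := I \ J) (L := L) (J := K) (T := T)
    ((Finset.card_le_card Finset.sdiff_subset).trans hP.card.le)
    (fun i hi => hP.sub i (hI i hi)) (fun i hi => hP.hi i (hI i hi))
    (fun i hi j hj => hP.tpl.near i (hI i hi) j (hI j hj))
    ⟨fun k hk => (hT.sub k hk).trans hM, hT.lo, hT.hi, hT.near⟩ ?_
  · have h2 := Finset.sum_sdiff hJ (f := fun i => (L i).card)
    omega
  · intro k hk x hx i hi
    have hxJ := hMJ x (hT.sub k hk hx)
    rw [Finset.mem_sdiff] at hi
    have : i ∉ Jv G P I L x := by rw [hxJ]; exact hi.2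
    rw [mem_Jv] at this
    have h3 : ¬ P.q ≤ (nn G x (L i)).card := fun h => this ⟨hi.1, h⟩
    omega

/-- `v` has few neighbours among vertices anticomplete to the template. -/
lemma Pack.Rdeg (hH : HF G P.s) (hR : Ram G P.s P.r) (hP : Pack G P A I L) (hI2 : 2 ≤ I.card)
    {R : Finset V} (hRU : ∀ x ∈ R, ∀ u ∈ I.biUnion L, ¬ G.Adj x u) {v : V}
    (hv : v ∈ I.biUnion L ∨ ((∃ u ∈ I.biUnion L, G.Adj v u) ∧ (Jv G P I L v).Nonempty)) :
    (nb G v R).card ≤ P.r := by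
  rcases hv with hv | ⟨⟨x, hx, hvx⟩, j, hj⟩
  · have : nb G v R = ∅ := by
      rw [Finset.eq_empty_iff_forall_notMem]
      intro y hy
      rw [mem_nb] at hy
      exact hRU y hy.1 v hv hy.2.symm
    rw [this]; simp
  · have main : ∀ i ∈ I, ∀ j ∈ Jv G P I L v, i ≠ j → ∀ x ∈ L i, G.Adj v x →
        (nb G v R).card ≤ P.r := by
      intro i hi j hj hij x hx hvx
      rw [mem_Jv] at hj
      have hn := hP.near i hi j hj.1 hij x hx
      refine (HF_big hH hR hvx.symm (X := nb G x (nn G v (L j))) (Y := nb G v R) ?_ ?_ ?_ ?_).le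
      · intro a ha
        simp only [mem_nb, mem_nn] at ha
        tauto
      · intro b hb
        rw [mem_nb] at hb
        exact ⟨hb.2, fun h => hRU b hb.1 x (Finset.mem_biUnion.2 ⟨i, hi, hx⟩) h.symm⟩
      · intro a ha b hb h
        rw [mem_nb] at hb
        simp only [mem_nb, mem_nn] at ha
        exact hRU b hb.1 a (Finset.mem_biUnion.2 ⟨j, hj.1, ha.1.1⟩) h.symm
      · have h2 := nb_add_nn (G := G) x (nn G v (L j))
        have h3 := Finset.card_le_card (nn_mono (G := G) (v := x)
          (nn_sub (G := G) (v := v) (X := L j)))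
        have := P.rq0
        omega
    obtain ⟨i, hi, hxi⟩ := Finset.mem_biUnion.1 hx
    by_cases hij : i = j
    · subst hij
      obtain ⟨k, hk, hki⟩ := Finset.exists_mem_ne (by omega : 1 < I.card) i
      by_cases hkn : ∃ y ∈ L k, G.Adj v y
      · obtain ⟨y, hy, hvy⟩ := hkn
        exact main k hk i hj hki y hy hvy
      · push Not at hkn
        refine main i hi k ?_ hki.symm x hxi hvx
        rw [mem_Jv]
        refine ⟨hk, ?_⟩
        have : nn G v (L k) = L k := by
          ext y; rw [mem_nn]; exact ⟨fun h => h.1, fun h => ⟨h, hkn y h⟩⟩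
        rw [this]
        have := hP.lo k hk
        have := P.rql
        omega
    · exact main i hi j hj hij x hxi hvx

lemma Pack.cwM (hw : CB G P.w) (hP : Pack G P A I L) {o : ℕ} (ho : cw G A ≤ o)
    {M : Finset V} (hM : M ⊆ A) {i : ι} (hi : i ∈ I) (hMi : ∀ v ∈ M, i ∉ Jv G P I L v) :
    cw G M ≤ o - 1 := by
  refine cw_le (fun K hK hc => ?_)
  have h1 := hw K hc
  have h2 : ∀ k ∈ K, (nn G k (L i)).card ≤ P.q := by
    intro k hk
    have := hMi k (hK hk)
    rw [mem_Jv] at this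
    have h3 : ¬ P.q ≤ (nn G k (L i)).card := fun h => this ⟨hi, h⟩
    omega
  have h3 : K.card * P.q < (L i).card := by
    have := Nat.mul_le_mul_right P.q h1.le
    have := P.hwq
    have := hP.lo i hi
    omega
  obtain ⟨x, hx, hxK⟩ := common_nb h2 h3
  obtain ⟨h4, h5⟩ := clique_insert hc hxK
  have := le_cw (Finset.insert_subset (hP.sub i hi hx) (hK.trans hM)) h4
  omega

/-- vertices of different purity types are sparsely connected. -/
lemma Pack.cross (hH : HF G P.s) (hR : Ram G P.s P.r) (hP : Pack G P A I L) {v : V}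
    {i j : ι} (hi : i ∈ I) (hj : j ∈ I) (hiv : i ∉ Jv G P I L v) (hjv : ∀ p ∈ L j, ¬ G.Adj v p)
    {Q : Finset V} (hQ : ∀ z ∈ Q, G.Adj v z ∧ (∀ p ∈ L i, ¬ G.Adj z p) ∧ ∀ p ∈ L j, ¬ G.Adj z p)
    (hij : i ≠ j) : Q.card ≤ P.r := by
  have h1 : ¬ P.q ≤ (nn G v (L i)).card := fun h => hiv (mem_Jv.2 ⟨hi, h⟩)
  have h2 := nb_add_nn (G := G) v (L i)
  have h3 := hP.lo i hi
  have h4 := P.rql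
  have h5 := P.r1
  have : (nb G v (L i)).Nonempty := by
    rw [← Finset.card_pos]; omega
  obtain ⟨x, hx⟩ := this
  rw [mem_nb] at hx
  refine (HF_big hH hR hx.2.symm (X := nb G x (L j)) (Y := Q) ?_ ?_ ?_ ?_).le
  · intro a ha
    rw [mem_nb] at ha
    exact ⟨ha.2, hjv a ha.1⟩
  · intro b hb
    exact ⟨(hQ b hb).1, fun h => (hQ b hb).2.1 x hx.1 h.symm⟩
  · intro a ha b hb h
    rw [mem_nb] at ha
    exact (hQ b hb).2.2 a ha.1 h.symm
  · have h6 := nb_add_nn (G := G) x (L j)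
    have h7 := hP.near i hi j hj hij x hx.1
    have h8 := hP.lo j hj
    have h9 := P.rq0
    omega

/-- colouring the pure vertices. -/
lemma Pack.colM (hH : HF G P.s) (hR : Ram G P.s P.r) (hw : CB G P.w) (hP : Pack G P A I L)
    (hI2 : 2 ≤ I.card) {o c d : ℕ} (ho : cw G A ≤ o)
    (IH : ∀ (M : Finset V) (K : ℕ), cw G M ≤ o - 1 → CoreLe G P M K → Col G M (c * K + 1) d)
    {M : Finset V} (hMA : M ⊆ A) (hMp : ∀ v ∈ M, ¬ Pend G P.s (I.biUnion L) v)
    (hMn : ∀ v ∈ M, ∃ u ∈ I.biUnion L, G.Adj v u)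
    (hM2 : ∀ v ∈ M, 2 ≤ (Jv G P I L v).card) :
    Col G M (∑ j ∈ I, (c * ((L j).card + (P.E1 + P.EM)) + 1)) (d + P.w * P.w * P.r) := by
  let B : ι → ℕ := fun j => c * ((L j).card + (P.E1 + P.EM)) + 1
  let pal : Finset ι → Finset (Σ _ : ι, ℕ) := fun J => J.sigma (fun j => Finset.range (B j))
  let MJ : Finset ι → Finset V := fun J => M.filter (fun v => Jv G P I L v = J)
  have hpure : ∀ v ∈ M, ∀ i ∈ Jv G P I L v, ∀ p ∈ L i, ¬ G.Adj v p :=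
    fun v hv i hi => hP.pure2 hR (hMp v hv) (hM2 v hv) hi
  have hcol : ∀ J : Finset ι, J ⊆ I → J.Nonempty → ∃ f : V → (Σ _ : ι, ℕ),
      (∀ v ∈ MJ J, f v ∈ pal J) ∧ ∀ c, ∀ C ⊆ MJ J, (∀ v ∈ C, f v = c) → C.Nonempty →
      ∃ v ∈ C, (nb G v C).card ≤ d := by
    intro J hJ hne
    have hMJ : ∀ v ∈ MJ J, Jv G P I L v = J := fun v hv => (Finset.mem_filter.1 hv).2
    have hMM : MJ J ⊆ M := Finset.filter_subset _ _
    have hcw : cw G (MJ J) ≤ o - 1 := by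
      by_cases hMne : (MJ J).Nonempty
      · obtain ⟨v, hv⟩ := hMne
        obtain ⟨u, hu, hvu⟩ := hMn v (hMM hv)
        obtain ⟨i, hi, hui⟩ := Finset.mem_biUnion.1 hu
        refine hP.cwM hw ho (hMM.trans hMA) hi ?_
        intro z hz
        rw [hMJ z hz, ← hMJ v hv]
        intro hiv
        exact hpure v (hMM hv) i hiv u hui hvu
      · rw [Finset.not_nonempty_iff_eq_empty] at hMne
        rw [hMne]
        refine cw_le (fun K hK _ => ?_)
        rw [Finset.subset_empty] at hK
        simp [hK]
    have h1 := IH (MJ J) _ hcw (hP.coreJ hw J hJ (hMM.trans hMA) hMJ)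
    have hJ1 : 1 ≤ J.card := hne.card_pos
    have hcard : c * (∑ j ∈ J, (L j).card + (P.E1 + P.EM)) + 1 ≤ (pal J).card := by
      simp only [pal, Finset.card_sigma, Finset.card_range, B]
      rw [Finset.sum_add_distrib, ← Finset.mul_sum, Finset.sum_add_distrib]
      simp only [Finset.sum_const, smul_eq_mul, mul_one]
      have : c * (∑ j ∈ J, (L j).card + (P.E1 + P.EM))
        ≤ c * (∑ j ∈ J, (L j).card + J.card * (P.E1 + P.EM)) := by
        refine Nat.mul_le_mul_left _ (Nat.add_le_add_left ?_ _)
        exact Nat.le_mul_of_pos_left _ hJ1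
      omega
    exact h1.to_fin (pal J) hcard (by rw [← Finset.card_pos]; omega)
  have hIne : I.Nonempty := by rw [← Finset.card_pos]; omega
  obtain ⟨i0, hi0⟩ := hIne
  have : Nonempty (Σ _ : ι, ℕ) := ⟨⟨i0, 0⟩⟩
  choose! f hf1 hf2 using hcol
  have hJne : ∀ v ∈ M, (Jv G P I L v).Nonempty := by
    intro v hv
    rw [← Finset.card_pos]
    have := hM2 v hv
    omega
  have hfv : ∀ v ∈ M, f (Jv G P I L v) v ∈ pal (Jv G P I L v) := fun v hv =>
    hf1 _ (Jv_sub v) (hJne v hv) v (Finset.mem_filter.2 ⟨hv, rfl⟩)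
  refine Col.of_fin (pal I) (fun v => f (Jv G P I L v) v) ?_ ?_ ?_
  · intro v hv
    have := hfv v hv
    simp only [pal, Finset.mem_sigma] at this ⊢
    exact ⟨Jv_sub v this.1, this.2⟩
  · intro c hc C hC hCc hne
    have hCM : ∀ v ∈ C, v ∈ M ∧ f (Jv G P I L v) v = c := fun v hv => ⟨hC hv, hCc v hv⟩
    obtain ⟨v0, hv0, hmin⟩ := Finset.exists_min_image C (fun v => (Jv G P I L v).card) hne
    set J := Jv G P I L v0 with hJ
    let C2 := C.filter (fun v => Jv G P I L v = J)
    obtain ⟨v, hv, hdeg⟩ := hf2 J (Jv_sub v0) (hJne v0 (hCM v0 hv0).1) c C2 (by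
      intro z hz
      obtain ⟨hz1, hz2⟩ := Finset.mem_filter.1 hz
      exact Finset.mem_filter.2 ⟨(hCM z hz1).1, hz2⟩) (by
      intro z hz
      obtain ⟨hz1, hz2⟩ := Finset.mem_filter.1 hz
      rw [← hz2]; exact (hCM z hz1).2) ⟨v0, Finset.mem_filter.2 ⟨hv0, rfl⟩⟩
    obtain ⟨hvC, hvJ⟩ := Finset.mem_filter.1 hv
    refine ⟨v, hvC, ?_⟩
    let Q : ι × ι → Finset V := fun z => C.filter (fun y => G.Adj v y ∧
      (∀ p ∈ L z.1, ¬ G.Adj y p) ∧ ∀ p ∈ L z.2, ¬ G.Adj y p)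
    have hcov : nb G v C ⊆ nb G v C2 ∪ ((I \ J) ×ˢ J).biUnion Q := by
      intro y hy
      obtain ⟨hyC, hvy⟩ := mem_nb.1 hy
      by_cases hyJ : Jv G P I L y = J
      · exact Finset.mem_union_left _ (mem_nb.2 ⟨Finset.mem_filter.2 ⟨hyC, hyJ⟩, hvy⟩)
      · refine Finset.mem_union_right _ ?_
        have hns : ¬ Jv G P I L y ⊆ J := fun hs =>
          hyJ (Finset.eq_of_subset_of_card_le hs (hmin y hyC))
        rw [Finset.not_subset] at hns
        obtain ⟨i, hiy, hiJ⟩ := hns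
        have e1 := hfv v (hCM v hvC).1
        have e2 := hfv y (hCM y hyC).1
        rw [(hCM v hvC).2, hvJ] at e1
        rw [(hCM y hyC).2] at e2
        simp only [pal, Finset.mem_sigma] at e1 e2
        refine Finset.mem_biUnion.2 ⟨(i, c.1), ?_, Finset.mem_filter.2 ⟨hyC, hvy, ?_, ?_⟩⟩
        · rw [Finset.mem_product, Finset.mem_sdiff]
          exact ⟨⟨Jv_sub y hiy, hiJ⟩, e1.1⟩
        · exact hpure y (hCM y hyC).1 i hiy
        · exact hpure y (hCM y hyC).1 c.1 e2.1
    have hQ : (((I \ J) ×ˢ J).biUnion Q).card ≤ P.w * P.w * P.r := by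
      refine (Finset.card_biUnion_le_card_mul _ _ P.r ?_).trans (Nat.mul_le_mul_right _ ?_)
      · rintro ⟨i, j⟩ hz
        rw [Finset.mem_product, Finset.mem_sdiff] at hz
        simp only at hz
        refine hP.cross hH hR hz.1.1 (Jv_sub v0 hz.2) (by rw [hvJ]; exact hz.1.2)
          (hpure v (hCM v hvC).1 j (by rw [hvJ]; exact hz.2))
          (fun y hy => (Finset.mem_filter.1 hy).2) (fun e => hz.1.2 (e ▸ hz.2))
      · rw [Finset.card_product]
        exact Nat.mul_le_mul ((Finset.card_le_card Finset.sdiff_subset).trans hP.card.le)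
          ((Finset.card_le_card (Jv_sub v0)).trans hP.card.le)
    have := (Finset.card_le_card hcov).trans (Finset.card_union_le _ _)
    omega
  · simp only [pal, Finset.card_sigma, Finset.card_range, B]
    exact le_rfl

/-- colouring everything attached non-densely to the template. -/
lemma Pack.colY (hH : HF G P.s) (hR : Ram G P.s P.r) (hw : CB G P.w) (hP : Pack G P A I L)
    (hI2 : 2 ≤ I.card) {o d K : ℕ} (ho1 : 1 ≤ o) (how : o ≤ P.w) (ho : cw G A ≤ o)
    (hK : CoreLe G P A K) (hNK : 2 * P.N ≤ K)
    (hd1 : P.w * (2 * P.N) ≤ d)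
    (hd2 : P.w * P.N + (P.w * P.N) * (P.w * P.N) * (P.w * P.N) ^ P.s * P.r ≤ d)
    (IH : ∀ (M : Finset V) (K : ℕ), cw G M ≤ o - 1 → CoreLe G P M K →
      Col G M ((P.w + 2) * (o - 1) * K + 1) d)
    {Y : Finset V} (hYA : Y ⊆ A)
    (hY : ∀ v ∈ Y, v ∈ I.biUnion L ∨
      ((∃ u ∈ I.biUnion L, G.Adj v u) ∧ (Jv G P I L v).Nonempty)) :
    Col G Y ((P.w + 2) * o * K) (d + P.w * P.w * P.r) := by
  set U := I.biUnion L with hU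
  have hUc : U.card ≤ P.w * P.N := by
    refine (Finset.card_biUnion_le_card_mul _ _ P.N hP.hi).trans
      (Nat.mul_le_mul_right _ hP.card.le)
  let D : ι → Finset V := fun j => A.filter (fun v => Jv G P I L v = {j})
  let M := A.filter (fun v => ¬ Pend G P.s U v ∧ (∃ u ∈ U, G.Adj v u) ∧ 2 ≤ (Jv G P I L v).card)
  have c1 : Col G (U ∪ A.filter (Pend G P.s U)) 1 (d + P.w * P.w * P.r) := by
    refine Col.of_degen ((degen_card _).mono le_rfl ?_)
    refine (Finset.card_union_le _ _).trans ?_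
    have h1 := pend_bound hH hR A U
    have h2 : U.card * U.card * U.card ^ P.s * P.r
        ≤ (P.w * P.N) * (P.w * P.N) * (P.w * P.N) ^ P.s * P.r := by gcongr
    omega
  have c2 : Col G (I.biUnion D) I.card (d + P.w * P.w * P.r) := by
    refine Col.biUnion I D _ (fun j hj => ?_)
    have h1 := hP.coreJ hw {j} (by simpa using hj) (M := D j) (Finset.filter_subset _ _)
      (fun v hv => (Finset.mem_filter.1 hv).2)
    have h2 : CoreLe G P (D j) (2 * P.N - 1) := by
      intro κ J T hT
      have h3 := h1 κ J T hT
      rw [Finset.sum_singleton] at h3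
      have := hP.hi j hj
      have := P.hhN
      omega
    refine (kst hH hR hw h2).mono le_rfl (by omega)
  have c3 := hP.colM hH hR hw hI2 ho IH (M := M) (Finset.filter_subset _ _)
    (fun v hv => (Finset.mem_filter.1 hv).2.1) (fun v hv => (Finset.mem_filter.1 hv).2.2.1)
    (fun v hv => (Finset.mem_filter.1 hv).2.2.2)
  refine ((c1.union c2).union c3).mono ?_ ?_ le_rfl
  · intro v hv
    have hvA := hYA hv
    simp only [Finset.mem_union]
    rcases hY v hv with h | ⟨h1, h2⟩
    · exact Or.inl (Or.inl (Or.inl h))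
    · by_cases hp : Pend G P.s U v
      · exact Or.inl (Or.inl (Or.inr (Finset.mem_filter.2 ⟨hvA, hp⟩)))
      · by_cases h3 : 2 ≤ (Jv G P I L v).card
        · exact Or.inr (Finset.mem_filter.2 ⟨hvA, hp, h1, h3⟩)
        · have h4 : (Jv G P I L v).card = 1 := by
            have := h2.card_pos
            omega
          obtain ⟨j, hj⟩ := Finset.card_eq_one.1 h4
          refine Or.inl (Or.inr (Finset.mem_biUnion.2 ⟨j, ?_, Finset.mem_filter.2 ⟨hvA, hj⟩⟩))
          have : j ∈ Jv G P I L v := by rw [hj]; simp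
          exact Jv_sub v this
  · have hcore := hK _ _ _ hP.tpl
    rw [Finset.sum_add_distrib, ← Finset.mul_sum, Finset.sum_add_distrib]
    simp only [Finset.sum_const, smul_eq_mul, mul_one]
    have hIw := hP.card.le
    obtain ⟨p, rfl⟩ : ∃ p, o = p + 1 := ⟨o - 1, by omega⟩
    simp only [Nat.add_sub_cancel]
    set δ := P.E1 + P.EM with hδ'
    have hδ := P.hδ
    have hN1 : 1 ≤ P.N := by have := P.hhN; omega
    have h1 : (P.w + 2) * p * (∑ i ∈ I, (L i).card + I.card * δ)
        ≤ (P.w + 2) * p * K + (P.w + 2) * P.N := by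
      calc _ ≤ (P.w + 2) * p * (K + P.w * δ) := by gcongr
        _ = (P.w + 2) * p * K + (P.w + 2) * (p * (P.w * δ)) := by ring
        _ ≤ (P.w + 2) * p * K + (P.w + 2) * (P.w * (P.w * δ)) := by gcongr; omega
        _ ≤ _ := by gcongr
    have h2 : (P.w + 2) * (p + 1) * K = (P.w + 2) * p * K + (P.w + 2) * K := by ring
    have h3 : (P.w + 2) * (2 * P.N) ≤ (P.w + 2) * K := by gcongr
    have h4 : (P.w + 2) * (2 * P.N) = (P.w + 2) * P.N + (P.w + 2) * P.N := by ring
    have h5 : 2 * P.w + 1 ≤ (P.w + 2) * P.N := by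
      have hN2 : 2 ≤ P.N := by
        have := P.hhN
        have := P.hE1
        have := P.hh
        have : 1 ≤ P.w * P.q0 := Nat.mul_pos (by have := P.w2; omega) P.hq0
        omega
      have := Nat.mul_le_mul_left (P.w + 2) hN2
      omega
    omega

end pack
end DS

namespace DS
open Classical
variable {V : Type} {G : SimpleGraph V} {P : Par}

/-- the set `Z` is locally densely attached to large near-complete families. -/
def Inv (G : SimpleGraph V) (P : Par) (A : Finset V) (K : ℕ) (Z : Finset V) : Prop :=
  ∀ C ⊆ Z, C.Nonempty → ∃ c ∈ C, ∃ (ι : Type) (I : Finset ι) (L : ι → Finset V),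
    I.card ≤ P.w ∧ (∀ i ∈ I, L i ⊆ A) ∧ (∀ i ∈ I, (L i).card ≤ P.N) ∧
    (∀ i ∈ I, ∀ j ∈ I, i ≠ j → ∀ x ∈ L i, (nn G x (L j)).card ≤ P.m) ∧
    K ≤ ∑ i ∈ I, (L i).card + P.h + P.E1 ∧ (∀ i ∈ I, (nn G c (L i)).card < P.q) ∧
    ∀ c' ∈ C, G.Adj c c' → ∀ i ∈ I, (nn G c' (L i)).card ≤ 2 * P.q

lemma Inv.degen (hw : CB G P.w) {A : Finset V} {K : ℕ} {Z : Finset V} (hZ : Inv G P A K Z)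
    (hZA : Z ⊆ A) (hK : CoreLe G P A K) : Degen G Z P.N := by
  intro C hC hne
  obtain ⟨c, hc, ι, I, L, h1, h2, h3, h4, h5, -, h7⟩ := hZ C hC hne
  refine ⟨c, hc, ?_⟩
  by_contra hcon
  push Not at hcon
  obtain ⟨T, hT, hTc⟩ := Finset.exists_subset_card_eq hcon.le
  have hTpl : Tpl G P A (Finset.univ : Finset Unit) (fun _ => T) := by
    refine ⟨?_, ?_, ?_, ?_⟩
    · intro _ _; exact hT.trans (nb_sub.trans (hC.trans hZA))
    · intro _ _; rw [hTc]; exact P.nN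
    · intro _ _; exact hTc.le
    · intro i _ j _ hij; exact absurd rfl hij
  have := merge hw hK h1 h2 h3 h4 hTpl (fun _ _ x hx i hi => by
    have := mem_nb.1 (hT hx)
    exact h7 x this.1 this.2 i hi)
  simp only [Finset.univ_unique, Finset.sum_singleton, hTc] at this
  have := P.hhN
  omega

lemma stage (hH : HF G P.s) (hR : Ram G P.s P.r) (hw : CB G P.w)
    {o d e K : ℕ} (ho1 : 1 ≤ o) (how : o ≤ P.w) (hNK : 2 * P.N ≤ K)
    (hd1 : P.w * (2 * P.N) ≤ d)
    (hd2 : P.w * P.N + (P.w * P.N) * (P.w * P.N) * (P.w * P.N) ^ P.s * P.r ≤ d)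
    (hde : d + P.w * P.w * P.r + P.r ≤ e)
    (IH : ∀ (M : Finset V) (K : ℕ), cw G M ≤ o - 1 → CoreLe G P M K →
      Col G M ((P.w + 2) * (o - 1) * K + 1) d)
    (IHK : ∀ A : Finset V, cw G A ≤ o → CoreLe G P A (K - P.h) →
      Col G A ((P.w + 2) * o * K) e) (nA : ℕ) :
    ∀ A : Finset V, A.card = nA → cw G A ≤ o → CoreLe G P A K →
      ∃ U Z : Finset V, U ⊆ A ∧ Z ⊆ A ∧ A ⊆ U ∪ Z ∧ Col G U ((P.w + 2) * o * K) e ∧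
        Inv G P A K Z := by
  induction nA using Nat.strong_induction_on with
  | _ nA ihA =>
  intro A hAc hcw hK
  by_cases hKh : CoreLe G P A (K - P.h)
  · refine ⟨A, ∅, le_rfl, by simp, by simp, IHK A hcw hKh, ?_⟩
    intro C hC hne
    rw [Finset.subset_empty] at hC
    simp [hC] at hne
  unfold CoreLe at hKh
  push Not at hKh
  obtain ⟨κ, J, T, hT, hTK⟩ := hKh
  obtain ⟨ι, I, L, hP⟩ := exists_pack hH hR hw A
  have hcore := hP.core κ J T hT
  have hhN := P.hhN
  have hI2 : 2 ≤ I.card := by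
    by_contra hcon
    have h1 : ∑ i ∈ I, (L i).card ≤ I.card * P.N := by
      simpa using Finset.sum_le_sum (g := fun _ => P.N) hP.hi
    have h2 : I.card * P.N ≤ 1 * P.N := Nat.mul_le_mul_right _ (by omega)
    omega
  set U := I.biUnion L with hU
  have hUA : U ⊆ A := by
    intro x hx
    obtain ⟨i, hi, hx⟩ := Finset.mem_biUnion.1 hx
    exact hP.sub i hi hx
  have hIne : I.Nonempty := by rw [← Finset.card_pos]; omega
  obtain ⟨i0, hi0⟩ := hIne
  have hLi0 : P.r + P.q ≤ (L i0).card := by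
    have := hP.lo i0 hi0
    have := P.rql
    omega
  have hUne : U.Nonempty := by
    have : (L i0).Nonempty := by
      rw [← Finset.card_pos]; have := P.r1; omega
    obtain ⟨x, hx⟩ := this
    exact ⟨x, Finset.mem_biUnion.2 ⟨i0, hi0, hx⟩⟩
  let Z1 := A.filter (fun v => v ∉ U ∧ (∃ u ∈ U, G.Adj v u) ∧ ¬ (Jv G P I L v).Nonempty)
  let R := A.filter (fun v => v ∉ U ∧ ¬ ∃ u ∈ U, G.Adj v u)
  let Y := A.filter (fun v => v ∈ U ∨ ((∃ u ∈ U, G.Adj v u) ∧ (Jv G P I L v).Nonempty))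
  have hRA : R ⊆ A := Finset.filter_subset _ _
  have hYA : Y ⊆ A := Finset.filter_subset _ _
  have hZA : Z1 ⊆ A := Finset.filter_subset _ _
  have hcov : A ⊆ (Y ∪ R) ∪ Z1 := by
    intro v hv
    simp only [Finset.mem_union, Y, R, Z1, Finset.mem_filter, hv, true_and]
    generalize (∃ u ∈ U, G.Adj v u) = p1
    generalize (Jv G P I L v).Nonempty = p2
    by_cases h1 : v ∈ U <;> by_cases h2 : p1 <;> by_cases h3 : p2 <;> simp [h1, h2, h3]
  have hRc : R.card < nA := by
    rw [← hAc]
    refine Finset.card_lt_card ⟨hRA, fun h => ?_⟩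
    obtain ⟨x, hx⟩ := hUne
    exact (Finset.mem_filter.1 (h (hUA hx))).2.1 hx
  have hRU : ∀ x ∈ R, ∀ u ∈ U, ¬ G.Adj x u := by
    intro x hx u hu h
    exact (Finset.mem_filter.1 hx).2.2 ⟨u, hu, h⟩
  obtain ⟨U2, Z2, hU2R, hZ2R, hcov2, hcol2, hinv2⟩ :=
    ihA R.card hRc R rfl ((cw_mono hRA).trans hcw) (hK.mono P hRA)
  have hcolY := hP.colY hH hR hw hI2 ho1 how hcw hK hNK hd1 hd2 IH hYA
    (fun v hv => (Finset.mem_filter.1 hv).2)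
  have hZ1q : ∀ c ∈ Z1, ∀ i ∈ I, (nn G c (L i)).card < P.q := by
    intro c hc i hi
    by_contra h
    exact (Finset.mem_filter.1 hc).2.2.2 ⟨i, mem_Jv.2 ⟨hi, not_lt.1 h⟩⟩
  refine ⟨Y ∪ U2, Z1 ∪ Z2, Finset.union_subset hYA (hU2R.trans hRA),
    Finset.union_subset hZA (hZ2R.trans hRA), ?_, ?_, ?_⟩
  · intro v hv
    have h1 := hcov hv
    simp only [Finset.mem_union] at h1 ⊢
    rcases h1 with (h1 | h1) | h1
    · exact Or.inl (Or.inl h1)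
    · rcases Finset.mem_union.1 (hcov2 h1) with h2 | h2
      · exact Or.inl (Or.inr h2)
      · exact Or.inr (Or.inr h2)
    · exact Or.inr (Or.inl h1)
  · refine hcolY.join hcol2 hde ?_
    intro v hv
    exact (Finset.card_le_card (nb_mono hU2R)).trans
      (hP.Rdeg hH hR hI2 hRU (Finset.mem_filter.1 hv).2)
  · intro C hC hne
    by_cases hCZ : (C ∩ Z2).Nonempty
    · obtain ⟨c, hc, ι', I', L', h1, h2, h3, h4, h5, h6, h7⟩ :=
        hinv2 (C ∩ Z2) Finset.inter_subset_right hCZ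
      obtain ⟨hcC, hcZ⟩ := Finset.mem_inter.1 hc
      have hcR := hZ2R hcZ
      refine ⟨c, hcC, ι', I', L', h1, fun i hi => (h2 i hi).trans hRA, h3, h4, h5, h6, ?_⟩
      intro c' hc' hcc' j hj
      by_cases hc'Z : c' ∈ Z2
      · exact h7 c' (Finset.mem_inter.2 ⟨hc', hc'Z⟩) hcc' j hj
      · have hc'1 : c' ∈ Z1 := by
          rcases Finset.mem_union.1 (hC hc') with h | h
          · exact h
          · exact absurd h hc'Z
        have hlt := HF_big hH hR hcc'.symm (X := nb G c' (L i0)) (Y := nb G c (nn G c' (L' j)))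
          ?_ ?_ ?_ ?_
        · have e1 := nb_add_nn (G := G) c (nn G c' (L' j))
          have e2 := Finset.card_le_card (nn_mono (G := G) (v := c)
            (nn_sub (G := G) (v := c') (X := L' j)))
          have e3 := h6 j hj
          have e4 := P.rq0
          omega
        · intro a ha
          rw [mem_nb] at ha
          exact ⟨ha.2, hRU c hcR a (Finset.mem_biUnion.2 ⟨i0, hi0, ha.1⟩)⟩
        · intro b hb
          simp only [mem_nb, mem_nn] at hb
          tauto
        · intro a ha b hb h
          rw [mem_nb] at ha
          simp only [mem_nb, mem_nn] at hb
          exact hRU b (h2 j hj hb.1.1) a (Finset.mem_biUnion.2 ⟨i0, hi0, ha.1⟩) h.symm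
        · have e1 := nb_add_nn (G := G) c' (L i0)
          have e2 := hZ1q c' hc'1 i0 hi0
          omega
    · have hC1 : ∀ c ∈ C, c ∈ Z1 := by
        intro c hc
        rcases Finset.mem_union.1 (hC hc) with h | h
        · exact h
        · exact absurd ⟨c, Finset.mem_inter.2 ⟨hc, h⟩⟩ hCZ
      obtain ⟨c, hc⟩ := hne
      refine ⟨c, hc, ι, I, L, hP.card.le, hP.sub, hP.hi, hP.tpl.near, by omega,
        hZ1q c (hC1 c hc), ?_⟩
      intro c' hc' _ i hi
      have := hZ1q c' (hC1 c' hc') i hi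
      omega

/-- base degeneracy. -/
def D0 (P : Par) : ℕ := P.w * (2 * P.N) +
  (P.w * P.N + (P.w * P.N) * (P.w * P.N) * (P.w * P.N) ^ P.s * P.r)

theorem claim (hH : HF G P.s) (hR : Ram G P.s P.r) (hw : CB G P.w) (o : ℕ) (how : o ≤ P.w) :
    ∀ (K : ℕ) (A : Finset V), cw G A ≤ o → CoreLe G P A K →
      Col G A ((P.w + 2) * o * K + 1) (D0 P + o * (P.w * P.w * P.r + P.r)) := by
  induction o with
  | zero =>
    intro K A hcw _
    have : A = ∅ := by
      rw [Finset.eq_empty_iff_forall_notMem]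
      intro x hx
      have := le_cw (G := G) (X := A) (K := {x}) (by simpa using hx) (by simp)
      simp at this
      omega
    rw [this]
    exact (Col.empty _).mono le_rfl (by omega) le_rfl
  | succ o iho =>
    intro K
    induction K using Nat.strong_induction_on with
    | _ K ihK =>
    intro A hcw hK
    have hwN : P.N ≤ P.w * (2 * P.N) := by
      have := P.w2
      nlinarith
    by_cases hNK : 2 * P.N ≤ K
    · have IH := iho (by omega)
      have hmul : (o + 1) * (P.w * P.w * P.r + P.r)
          = o * (P.w * P.w * P.r + P.r) + (P.w * P.w * P.r + P.r) := by ring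
      obtain ⟨U, Z, hUA, hZA, hcov, hcol, hinv⟩ := stage hH hR hw (o := o + 1)
        (d := D0 P + o * (P.w * P.w * P.r + P.r))
        (e := D0 P + (o + 1) * (P.w * P.w * P.r + P.r)) (K := K)
        (by omega) how hNK (by unfold D0; omega) (by unfold D0; omega) (by omega)
        (fun M K' h1 h2 => IH K' M (by simpa using h1) h2) (by
          intro A' hc' hK'
          have hh := P.hh
          have hhN := P.hhN
          refine (ihK (K - P.h) (by omega) A' hc' hK').mono le_rfl ?_ le_rfl
          have : (P.w + 2) * (o + 1) * (K - P.h) + (P.w + 2) * (o + 1) * P.h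
              = (P.w + 2) * (o + 1) * K := by
            rw [← mul_add]; congr 1; omega
          have h1 : 1 ≤ (P.w + 2) * (o + 1) * P.h := by
            apply Nat.mul_pos (Nat.mul_pos (by omega) (by omega)) hh
          omega) A.card A rfl hcw hK
      refine (hcol.union (Col.of_degen ((hinv.degen hw hZA hK).mono le_rfl ?_))).mono hcov
        le_rfl le_rfl
      unfold D0; omega
    · have h1 : CoreLe G P A (2 * P.N - 1) := by
        intro κ J T hT
        have := hK κ J T hT
        omega
      refine (Col.of_degen (kst hH hR hw h1)).mono le_rfl (by omega) ?_
      unfold D0; omega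

theorem final_col [Fintype V] (hH : HF G P.s) (hR : Ram G P.s P.r) (hw : CB G P.w) :
    G.Colorable (((P.w + 2) * P.w * (P.w * P.N) + 1) *
      (D0 P + P.w * (P.w * P.w * P.r + P.r) + 1)) := by
  have hK : CoreLe G P (Finset.univ : Finset V) (P.w * P.N) := by
    intro ι I L hT
    have h1 : ∑ i ∈ I, (L i).card ≤ I.card * P.N := by
      simpa using Finset.sum_le_sum (g := fun _ => P.N) hT.hi
    exact h1.trans (Nat.mul_le_mul_right _ (hT.card_lt hw).le)
  exact (claim hH hR hw P.w le_rfl _ _ (cw_lt hw _).le hK).colorable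

end DS

namespace DS
open Classical

/-- the concrete parameters. -/
theorem exists_par (w s : ℕ) (hw : 16 ≤ w) (hs : 1 ≤ s) :
    ∃ P : Par, P.s = s ∧ P.w = w ∧ P.r = w ^ s ∧ P.N = w ^ (s * s + 66 * s + 101 + 62) := by
  obtain ⟨c, hc⟩ : ∃ c, c = s * s + 66 * s + 100 := ⟨_, rfl⟩
  have hcs : s * s + 66 * s + 100 ≤ c := hc.ge
  have hss : s ≤ s * s := Nat.le_mul_self s
  obtain ⟨B, hB⟩ : ∃ B, B = c + 43 := ⟨_, rfl⟩
  have w1 : 1 < w := by omega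
  have w0 : 0 < w := by omega
  have hpos : ∀ i, 1 ≤ w ^ i := fun i => Nat.one_le_pow _ _ w0
  have hmono : ∀ i j, i ≤ j → w ^ i ≤ w ^ j := fun i j h => Nat.pow_le_pow_right w0 h
  have hst : ∀ i, w * w ^ i = w ^ (i + 1) := fun i => by rw [pow_succ, mul_comm]
  have h16 : ∀ i, 16 * w ^ i ≤ w ^ (i + 1) := fun i => by
    rw [← hst]; exact Nat.mul_le_mul_right _ hw
  have g0 := h16 B
  have g1 := h16 (B + 1)
  have g2 := h16 (B + 2)
  have g3 := h16 (B + 3)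
  have g4 := h16 (B + 4)
  have g5 := h16 (B + 5)
  have g6 := h16 (B + 6)
  have g7 := h16 (B + 7)
  have g8 := h16 (B + 8)
  have g9 := h16 (B + 9)
  have g10 := h16 (B + 10)
  have g11 := h16 (B + 11)
  have g12 := h16 (B + 12)
  have g13 := h16 (B + 13)
  have g14 := h16 (B + 14)
  have g15 := h16 (B + 15)
  have g16 := h16 (B + 16)
  have g17 := h16 (B + 17)
  have g18 := h16 (B + 18)
  have g19 := h16 (B + 19)
  have p0 := hpos B
  have hr0 := hmono s B (by omega)
  have ht0 := hmono (20 + s) B (by omega)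
  have hsr : s ≤ w ^ s := (Nat.lt_pow_self w1).le
  simp only [add_assoc, Nat.reduceAdd] at g1 g2 g3 g4 g5 g6 g7 g8 g9 g10 g11 g12 g13 g14 g15 g16 g17 g18 g19
  refine ⟨{ s := s, w := w, r := w ^ s, N := w ^ (B + 20), n := w ^ (B + 10), m := w ^ (B + 8),
            ν := w ^ (2 * c + 66), a := w ^ (c + 1), q := w ^ (B + 1), q0 := w ^ B,
            n0 := w ^ (B + 11), l := w ^ (B + 14), l1 := w ^ (B + 13), t := w ^ (20 + s),
            bb := w ^ (B + 15), h := 1, E1 := w ^ (B + 16), EM := w ^ (B + 17),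
            w2 := by omega, s1 := hs, r1 := hpos s, sr := hsr,
            ra := hmono _ _ (by omega), hν := ?_, big := ?_, wmn := ?_, νmN := ?_, nN := ?_,
            rm := ?_, qm := ?_, hbb := ?_, hEM := ?_, hl := ?_, m1 := ?_, hC := ?_, hq0m := ?_,
            hq0 := ?_, ht := ?_, hn0 := ?_, hnl := ?_, hwq := ?_, rq0 := ?_, rql := ?_, hE1 := ?_,
            hh := ?_, hhN := ?_, hδ := ?_ }, rfl, rfl, rfl, ?_⟩
  · -- product of N and a
    have : w ^ (B + 20) * w ^ (c + 1) = w ^ (2 * c + 64) := by rw [← pow_add]; congr 1; omega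
    have h1 := h16 (2 * c + 64)
    have h2 := h16 (2 * c + 65)
    simp only [add_assoc, Nat.reduceAdd] at h1 h2
    calc _ = 4 * (w ^ (B + 20) * w ^ (c + 1)) := by ring
      _ ≤ _ := by rw [this]; omega
  · have ha : w ^ c ≤ w ^ (c + 1) + 1 - s := by
      have h1 := h16 c
      have h2 := hmono s c (by omega)
      omega
    have hN : 2 * w ^ (B + 20) ≤ w ^ (B + 21) := by
      have := h16 (B + 20)
      simp only [add_assoc, Nat.reduceAdd] at this
      omega
    calc w ^ s * (w ^ s) ^ s * (2 * w ^ (B + 20)) ^ s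
        ≤ w ^ s * (w ^ s) ^ s * (w ^ (B + 21)) ^ s := by gcongr
      _ = w ^ (s + s * s + (B + 21) * s) := by rw [← pow_mul, ← pow_mul, ← pow_add, ← pow_add]
      _ < w ^ (c + 1 + c * s) := by
          apply Nat.pow_lt_pow_right w1
          subst hB
          have : (c + 43 + 21) * s = c * s + 64 * s := by ring
          omega
      _ = w ^ (c + 1) * (w ^ c) ^ s := by rw [← pow_mul, ← pow_add]
      _ ≤ _ := by gcongr
  · rw [hst]; simp only [add_assoc, Nat.reduceAdd]; omega
  · have : w ^ (B + 8) * w ^ (B + 20) = w ^ (2 * B + 28) := by rw [← pow_add]; congr 1; omega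
    have h1 := hmono (2 * c + 66) (2 * B + 28) (by omega)
    rw [add_mul, this]
    have := hpos (B + 20)
    omega
  · omega
  · omega
  · omega
  · have : w * (w ^ (B + 20) * (2 * w ^ (B + 1))) = 2 * w ^ (2 * B + 22) := by ring
    have h1 := h16 (2 * B + 22)
    have h2 : w ^ (B + 8) * w ^ (B + 15) = w ^ (2 * B + 23) := by rw [← pow_add]; congr 1; omega
    rw [this, h2]
    simp only [add_assoc, Nat.reduceAdd] at h1
    omega
  · rw [hst, hst]; simp only [add_assoc, Nat.reduceAdd]; omega
  · rw [hst, hst, hst]; simp only [add_assoc, Nat.reduceAdd]; omega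
  · omega
  · have h1 : w ^ (B + 12) ≤ w ^ (B + 13) - 2 * w ^ (B + 8) := by omega
    calc w * (w ^ (B + 20) * w ^ (B + 20) * w ^ (2 * c + 66)) = w ^ (2 * B + 2 * c + 107) := by ring
      _ < w ^ (4 * B + 24) := Nat.pow_lt_pow_right w1 (by omega)
      _ = w ^ B * w ^ B * (w ^ (B + 12) * w ^ (B + 12)) := by ring
      _ ≤ _ := by gcongr
  · omega
  · omega
  · have : w ^ (B + 20) * w ^ s = w ^ B * w ^ (20 + s) := by ring
    rw [this, mul_add]; omega
  · omega
  · omega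
  · rw [hst]; simp only [add_assoc, Nat.reduceAdd]; omega
  · omega
  · omega
  · rw [hst, hst, hst]; simp only [add_assoc, Nat.reduceAdd]; omega
  · omega
  · omega
  · rw [mul_add, hst, hst, mul_add, hst, hst]; simp only [add_assoc, Nat.reduceAdd]; omega
  · show w ^ (B + 20) = _
    rw [hB, hc]

/-- polynomial bound. -/
theorem poly_col (s : ℕ) (hs : 1 ≤ s) : ∃ f : Polynomial ℕ, ∀ (V : Type) [Fintype V]
    (G : SimpleGraph V), HF G s → G.chromaticNumber ≤ ((Polynomial.eval G.cliqueNum f : ℕ) : ℕ∞) := by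
  let w : Polynomial ℕ := Polynomial.X + Polynomial.C 16
  let r : Polynomial ℕ := w ^ s
  let N : Polynomial ℕ := w ^ (s * s + 66 * s + 101 + 62)
  refine ⟨((w + 2) * w * (w * N) + 1) * ((w * (2 * N) +
    (w * N + (w * N) * (w * N) * (w * N) ^ s * r)) + w * (w * w * r + r) + 1), ?_⟩
  intro V _ G hH
  obtain ⟨P, h1, h2, h3, h4⟩ := exists_par (G.cliqueNum + 16) s (by omega) hs
  have hw : CB G P.w := by
    intro K hK
    have := hK.card_le_cliqueNum
    omega
  have hR : Ram G P.s P.r := by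
    rw [h3, h1, ← h2]
    exact ramsey hw s
  have := final_col (P := P) (h1 ▸ hH) hR hw
  refine this.chromaticNumber_le.trans ?_
  apply le_of_eq
  congr 1
  simp only [D0, h1, h2, h3, h4, w, r, N, Polynomial.eval_add, Polynomial.eval_mul,
    Polynomial.eval_pow, Polynomial.eval_X, Polynomial.eval_C, Polynomial.eval_one,
    Polynomial.eval_ofNat]
end DS

namespace DS
open Classical

theorem closed_univ {W : Type} {H : SimpleGraph W} (hc : H.Connected) (C : Set W) (u : W)
    (hu : u ∈ C) (hC : ∀ a ∈ C, ∀ b, H.Adj a b → b ∈ C) : ∀ x, x ∈ C := by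
  intro x
  obtain ⟨p⟩ := hc.preconnected u x
  induction p with
  | nil => exact hu
  | cons h p ih => exact ih (hC _ hu _ h)

theorem deg_le_one {W : Type} [Fintype W] {H : SimpleGraph W} {a b c : W}
    (h : ¬ 1 < (H.neighborSet a).ncard) (hb : H.Adj a b) (hc : H.Adj a c) : b = c :=
  (Set.ncard_le_one (Set.toFinite _)).1 (not_lt.1 h) b hb c hc

/-- structure of double stars. -/
theorem double_star {W : Type} [Fintype W] (H : SimpleGraph W) (ht : H.IsTree)
    (hdeg : ({w : W | 1 < (H.neighborSet w).ncard}).ncard ≤ 2) :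
    (∃ u : W, ∀ x, x = u) ∨ ∃ u v, H.Adj u v ∧ ∀ x, x ≠ u → x ≠ v →
      ¬ 1 < (H.neighborSet x).ncard := by
  by_cases hsub : ∃ u : W, ∀ x, x = u
  · exact Or.inl hsub
  right
  have hc := ht.1
  have hnb : ∀ a : W, ∃ b, H.Adj a b := by
    intro a
    by_contra hcon
    push Not at hcon
    exact hsub ⟨a, fun x => closed_univ hc {a} a rfl
      (fun c hc b hb => by rw [Set.mem_singleton_iff] at hc; subst hc; exact (hcon b hb).elim) x⟩
  set D := {w : W | 1 < (H.neighborSet w).ncard} with hD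
  -- choose `u v` covering `D`
  by_cases h2 : D.ncard = 2
  · obtain ⟨u, v, huv, hDe⟩ := Set.ncard_eq_two.1 h2
    have hlow : ∀ x, x ≠ u → x ≠ v → ¬ 1 < (H.neighborSet x).ncard := by
      intro x hx hy h
      have : x ∈ D := h
      rw [hDe] at this
      rcases this with h | h
      · exact hx h
      · exact hy h
    refine ⟨u, v, ?_, hlow⟩
    by_contra hna
    have key := closed_univ hc {x | x = u ∨ H.Adj u x} u (Or.inl rfl) (by
      rintro a (rfl | ha) b hb
      · exact Or.inr hb
      · left
        have hav : a ≠ v := by rintro rfl; exact hna ha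
        exact deg_le_one (hlow a ha.ne' hav) hb ha.symm) v
    rcases key with h | h
    · exact huv h.symm
    · exact hna h
  · have h1 : D.ncard ≤ 1 := by omega
    have hne : Nonempty W := hc.nonempty
    obtain ⟨u, hu⟩ : ∃ u, ∀ x ∈ D, x = u := by
      rcases D.eq_empty_or_nonempty with h | ⟨u, hu⟩
      · exact ⟨hne.some, fun x hx => by rw [h] at hx; exact hx.elim⟩
      · exact ⟨u, fun x hx => (Set.ncard_le_one (Set.toFinite _)).1 h1 x hx u hu⟩
    obtain ⟨v, hv⟩ := hnb u
    exact ⟨u, v, hv, fun x hx _ h => hx (hu x h)⟩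

theorem not_free {V W : Type} {G : SimpleGraph V} {H : SimpleGraph W} (hf : IsInducedFree G H)
    (φ : W → V) (hi : Function.Injective φ) (ha : ∀ a b, G.Adj (φ a) (φ b) ↔ H.Adj a b) : False := by
  refine hf (Set.range φ) ⟨RelIso.symm ⟨Equiv.ofInjective φ hi, ?_⟩⟩
  intro a b
  exact ha a b

theorem exists_map {W V : Type} [Fintype W] (x : V) (S : Finset V) (h : S.card = Fintype.card W) :
    ∃ f : W → V, Function.Injective f ∧ ∀ a, f a ∈ S := by
  have e : W ≃ S := Fintype.equivOfCardEq (by simp [h])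
  exact ⟨fun a => e a, fun a b hab => e.injective (Subtype.ext hab), fun a => (e a).2⟩

theorem hf_of_free {W : Type} [Fintype W] (H : SimpleGraph W) (ht : H.IsTree)
    (hdeg : ({w : W | 1 < (H.neighborSet w).ncard}).ncard ≤ 2) {V : Type} (G : SimpleGraph V)
    (hf : IsInducedFree G H) : HF G (Fintype.card W) := by
  intro x y hxy S T hS hT hsS hsT hxS hyT hST
  rcases double_star H ht hdeg with ⟨u, hu⟩ | ⟨u, v, huv, hlow⟩
  · refine not_free hf (fun _ => x) (fun a b _ => (hu a).trans (hu b).symm) (fun a b => ?_)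
    rw [hu a, hu b]
    exact ⟨fun h => (h.ne rfl).elim, fun h => (h.ne rfl).elim⟩
  obtain ⟨f, fi, fS⟩ := exists_map x S hS
  obtain ⟨g, gi, gT⟩ := exists_map x T hT
  have huv' := huv.ne
  -- every vertex is `u`, `v` or attached to one of them
  have hcov : ∀ z, z = u ∨ z = v ∨ H.Adj u z ∨ H.Adj v z := by
    refine closed_univ ht.1 {z | z = u ∨ z = v ∨ H.Adj u z ∨ H.Adj v z} u (Or.inl rfl) ?_
    intro a ha b hb
    by_cases hau : a = u
    · subst hau; exact Or.inr (Or.inr (Or.inl hb))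
    by_cases hav : a = v
    · subst hav; exact Or.inr (Or.inr (Or.inr hb))
    rcases ha with h | h | h | h
    · exact (hau h).elim
    · exact (hav h).elim
    · exact Or.inl (deg_le_one (hlow a hau hav) hb h.symm)
    · exact Or.inr (Or.inl (deg_le_one (hlow a hau hav) hb h.symm))
  let φ : W → V := fun z => if z = u then x else if z = v then y else if H.Adj u z then f z else g z
  have φu : φ u = x := by simp [φ]
  have φv : φ v = y := by simp [φ, huv'.symm]
  have φf : ∀ z, z ≠ u → z ≠ v → H.Adj u z → φ z = f z := by
    intro z h1 h2 h3; simp [φ, h1, h2, h3]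
  have φg : ∀ z, z ≠ u → z ≠ v → ¬ H.Adj u z → φ z = g z := by
    intro z h1 h2 h3; simp [φ, h1, h2, h3]
  have key : ∀ z, z = u ∨ z = v ∨
      (z ≠ u ∧ z ≠ v ∧ φ z = f z ∧ ∀ b, H.Adj z b ↔ b = u) ∨
      (z ≠ u ∧ z ≠ v ∧ φ z = g z ∧ ∀ b, H.Adj z b ↔ b = v) := by
    intro z
    by_cases h1 : z = u
    · exact Or.inl h1
    by_cases h2 : z = v
    · exact Or.inr (Or.inl h2)
    right; right
    by_cases h3 : H.Adj u z
    · exact Or.inl ⟨h1, h2, φf z h1 h2 h3, fun b =>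
        ⟨fun hb => deg_le_one (hlow z h1 h2) hb h3.symm, fun hb => hb ▸ h3.symm⟩⟩
    · have h4 : H.Adj v z := by
        rcases hcov z with h | h | h | h
        · exact (h1 h).elim
        · exact (h2 h).elim
        · exact (h3 h).elim
        · exact h
      exact Or.inr ⟨h1, h2, φg z h1 h2 h3, fun b =>
        ⟨fun hb => deg_le_one (hlow z h1 h2) hb h4.symm, fun hb => hb ▸ h4.symm⟩⟩
  have xf : ∀ z, G.Adj x (f z) := fun z => (hxS _ (fS z)).1
  have yf : ∀ z, ¬ G.Adj y (f z) := fun z => (hxS _ (fS z)).2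
  have yg : ∀ z, G.Adj y (g z) := fun z => (hyT _ (gT z)).1
  have xg : ∀ z, ¬ G.Adj x (g z) := fun z => (hyT _ (gT z)).2
  have fg : ∀ a b, ¬ G.Adj (f a) (g b) := fun a b => hST _ (fS a) _ (gT b)
  have ff : ∀ a b, ¬ G.Adj (f a) (f b) := by
    intro a b h; exact hsS _ (fS a) _ (fS b) h
  have gg : ∀ a b, ¬ G.Adj (g a) (g b) := by
    intro a b h; exact hsT _ (gT a) _ (gT b) h
  have hadj : ∀ a b, G.Adj (φ a) (φ b) ↔ H.Adj a b := by
    intro a b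
    rcases key a with rfl | rfl | ⟨a1, a2, a3, a4⟩ | ⟨a1, a2, a3, a4⟩ <;>
    rcases key b with rfl | rfl | ⟨b1, b2, b3, b4⟩ | ⟨b1, b2, b3, b4⟩
    · simp
    · rw [φu, φv]; exact iff_of_true hxy huv
    · rw [φu, b3, H.adj_comm, b4]; simp [xf]
    · rw [φu, b3, H.adj_comm, b4]; exact iff_of_false (xg b) huv'
    · rw [φu, φv]; exact iff_of_true hxy.symm huv.symm
    · simp
    · rw [φv, b3, H.adj_comm, b4]; exact iff_of_false (yf b) huv'.symm
    · rw [φv, b3, H.adj_comm, b4]; simp [yg]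
    · rw [φu, a3, a4]; exact iff_of_true (xf a).symm rfl
    · rw [φv, a3, a4]; exact iff_of_false (fun h => yf a h.symm) huv'.symm
    · rw [a3, b3, a4]; exact iff_of_false (ff a b) b1
    · rw [a3, b3, a4]; exact iff_of_false (fg a b) b1
    · rw [φu, a3, a4]; exact iff_of_false (fun h => xg a h.symm) huv'
    · rw [φv, a3, a4]; exact iff_of_true (yg a).symm rfl
    · rw [a3, b3, a4]; exact iff_of_false (fun h => fg b a h.symm) b2
    · rw [a3, b3, a4]; exact iff_of_false (gg a b) b2
  refine not_free hf φ ?_ hadj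
  have hyx := hxy.symm
  have cfg : ∀ a b, f a ≠ g b := fun a b h => xg b (h ▸ xf a)
  have cxf : ∀ a, x ≠ f a := fun a h => (xf a).ne h
  have cyg : ∀ a, y ≠ g a := fun a h => (yg a).ne h
  have cxg : ∀ a, x ≠ g a := fun a h => fg a a (h ▸ (xf a).symm)
  have cyf : ∀ a, y ≠ f a := fun a h => fg a a (h ▸ yg a)
  intro a b hab
  rcases key a with rfl | rfl | ⟨a1, a2, a3, a4⟩ | ⟨a1, a2, a3, a4⟩ <;>
  rcases key b with rfl | rfl | ⟨b1, b2, b3, b4⟩ | ⟨b1, b2, b3, b4⟩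
  · rfl
  · rw [φu, φv] at hab; exact (hxy.ne hab).elim
  · rw [φu, b3] at hab; exact (cxf _ hab).elim
  · rw [φu, b3] at hab; exact (cxg _ hab).elim
  · rw [φu, φv] at hab; exact (hxy.ne hab.symm).elim
  · rfl
  · rw [φv, b3] at hab; exact (cyf _ hab).elim
  · rw [φv, b3] at hab; exact (cyg _ hab).elim
  · rw [φu, a3] at hab; exact (cxf _ hab.symm).elim
  · rw [φv, a3] at hab; exact (cyf _ hab.symm).elim
  · rw [a3, b3] at hab; exact fi hab
  · rw [a3, b3] at hab; exact (cfg _ _ hab).elim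
  · rw [φu, a3] at hab; exact (cxg _ hab.symm).elim
  · rw [φv, a3] at hab; exact (cyg _ hab.symm).elim
  · rw [a3, b3] at hab; exact (cfg _ _ hab.symm).elim
  · rw [a3, b3] at hab; exact gi hab
end DS

/-- For every double star `H` (a tree in which at most two vertices have degree more than one),
there is a polynomial `f` such that every `H`-free graph `G` satisfies `χ(G) ≤ f(ω(G))`. -/
theorem doubleStar_polynomial_chi_bounded (W : Type) [Fintype W] (H : SimpleGraph W)
    (htree : H.IsTree) (hdeg : ({w : W | 1 < (H.neighborSet w).ncard}).ncard ≤ 2) :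
    ∃ f : Polynomial ℕ, ∀ (V : Type) [Fintype V] (G : SimpleGraph V),
      IsInducedFree G H → G.chromaticNumber ≤ ((Polynomial.eval G.cliqueNum f : ℕ) : ℕ∞) := by
  have hne : Nonempty W := htree.1.nonempty
  obtain ⟨f, hf⟩ := DS.poly_col (Fintype.card W) Fintype.card_pos
  exact ⟨f, fun V _ G hG => hf V G (DS.hf_of_free H htree hdeg G hG)⟩
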